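/- arXiv:1203.2996 — 2 statements merged into one kernel-verified Lean document; each statement's English description precedes it below -/
import Mathlib

section
/- Let (s_n, t_n)_{n=1}^∞ be a sequence of pairs of nonnegative real numbers with s_n + t_n = 1 for all n, and let s = sup_{n ∈ ℕ} s_n. Then for every θ ∈ ℝ with inf_{q ∈ ℕ, q ≥ 1} q^(1/s) ‖qθ‖ > 0, the set ⋂_{n=1}^∞ Bad(s_n, t_n; θ) is thick in ℝ, i.e. for every nonempty open interval I ⊆ ℝ, the Hausdorff dimension of I ∩ ⋂_{n=1}^∞ Bad(s_n, t_n; θ) equals 1. -/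
noncomputable def dInt (x : ℝ) : ℝ := ⨅ n : ℤ, |x - n|

noncomputable def BadST (s t θ : ℝ) : Set ℝ :=
  {y : ℝ | 0 < ⨅ q : {q : ℕ // 0 < q},
      max ((q : ℝ) ^ s * dInt ((q : ℝ) * θ)) ((q : ℝ) ^ t * dInt ((q : ℝ) * y))}

open scoped ENNReal

def Dang (s t θ c : ℝ) (q : ℕ) (z : ℝ) : Prop :=
  0 < q ∧ ∃ p r : ℤ, |q * θ - p| * (q:ℝ) ^ s < c ∧ |q * z - r| * (q:ℝ) ^ t < c

lemma dInt_nonneg (x : ℝ) : 0 ≤ dInt x := Real.iInf_nonneg fun _ => abs_nonneg _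

lemma dInt_le (x : ℝ) (n : ℤ) : dInt x ≤ |x - n| :=
  ciInf_le ⟨0, by rintro _ ⟨n, rfl⟩; exact abs_nonneg _⟩ n

lemma bad_of_not_dang {s t θ c z : ℝ} (hc : 0 < c) (h : ∀ q, ¬ Dang s t θ c q z) :
    z ∈ BadST s t θ := by
  have : Nonempty {q : ℕ // 0 < q} := ⟨⟨1, one_pos⟩⟩
  refine lt_of_lt_of_le hc (le_ciInf fun q => ?_)
  by_contra hcon
  push Not at hcon
  obtain ⟨h1, h2⟩ := max_lt_iff.1 hcon
  have hq : (0:ℝ) < (q:ℕ) := by exact_mod_cast q.2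
  have hs : (0:ℝ) < ((q:ℕ):ℝ) ^ s := by positivity
  have ht : (0:ℝ) < ((q:ℕ):ℝ) ^ t := by positivity
  rw [mul_comm, ← lt_div_iff₀ hs] at h1
  rw [mul_comm, ← lt_div_iff₀ ht] at h2
  obtain ⟨p, hp⟩ := exists_lt_of_ciInf_lt h1
  obtain ⟨r, hr⟩ := exists_lt_of_ciInf_lt h2
  exact h q ⟨q.2, p, r, (lt_div_iff₀ hs).1 hp, (lt_div_iff₀ ht).1 hr⟩

lemma line_exists {s t : ℝ} (hs : 0 ≤ s) (ht : 0 ≤ t) (hst : s + t = 1) {q : ℕ} (hq : 0 < q)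
    (p r : ℤ) : ∃ A B C : ℤ, (A ≠ 0 ∨ B ≠ 0) ∧ |(A:ℝ)| ≤ (q:ℝ) ^ s ∧ |(B:ℝ)| ≤ (q:ℝ) ^ t ∧
      A * p + B * r + C * q = 0 := by
  have : NeZero q := ⟨hq.ne'⟩
  have hq0 : (0:ℝ) < q := by exact_mod_cast hq
  set a := ⌊(q:ℝ) ^ s⌋₊
  set b := ⌊(q:ℝ) ^ t⌋₊
  have ha : (a:ℝ) ≤ (q:ℝ) ^ s := Nat.floor_le (by positivity)
  have hb : (b:ℝ) ≤ (q:ℝ) ^ t := Nat.floor_le (by positivity)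
  have ha' : (q:ℝ) ^ s < a + 1 := Nat.lt_floor_add_one _
  have hb' : (q:ℝ) ^ t < b + 1 := Nat.lt_floor_add_one _
  let f : Fin (a+1) × Fin (b+1) → ZMod q := fun x => ((x.1:ℕ) : ZMod q) * p + ((x.2:ℕ) : ZMod q) * r
  have hcard : Fintype.card (ZMod q) < Fintype.card (Fin (a+1) × Fin (b+1)) := by
    rw [ZMod.card, Fintype.card_prod, Fintype.card_fin, Fintype.card_fin]
    have : (q:ℝ) < (a+1) * (b+1) := by
      calc (q:ℝ) = (q:ℝ) ^ s * (q:ℝ) ^ t := by rw [← Real.rpow_add hq0, hst, Real.rpow_one]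
        _ < _ := mul_lt_mul'' ha' hb' (by positivity) (by positivity)
    exact_mod_cast this
  obtain ⟨x, y, hne, hxy⟩ := Fintype.exists_ne_map_eq_of_card_lt f hcard
  have hdvd : (q:ℤ) ∣ (((x.1:ℕ):ℤ) - ((y.1:ℕ):ℤ)) * p + (((x.2:ℕ):ℤ) - ((y.2:ℕ):ℤ)) * r := by
    rw [← ZMod.intCast_zmod_eq_zero_iff_dvd]
    simp only [f] at hxy
    push_cast
    linear_combination hxy
  obtain ⟨C, hC⟩ := hdvd
  refine ⟨((x.1:ℕ):ℤ) - ((y.1:ℕ):ℤ), ((x.2:ℕ):ℤ) - ((y.2:ℕ):ℤ), -C, ?_, ?_, ?_, ?_⟩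
  · by_contra hcon
    push Not at hcon
    apply hne
    ext
    · have := hcon.1; omega
    · have := hcon.2; omega
  · refine le_trans ?_ ha
    have h1 : ((x.1:ℕ):ℝ) ≤ a := by exact_mod_cast Nat.lt_succ_iff.1 x.1.2
    have h2 : ((y.1:ℕ):ℝ) ≤ a := by exact_mod_cast Nat.lt_succ_iff.1 y.1.2
    have h3 : (0:ℝ) ≤ ((x.1:ℕ):ℝ) := by positivity
    have h4 : (0:ℝ) ≤ ((y.1:ℕ):ℝ) := by positivity
    push_cast
    rw [abs_le]; constructor <;> linarith
  · refine le_trans ?_ hb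
    have h1 : ((x.2:ℕ):ℝ) ≤ b := by exact_mod_cast Nat.lt_succ_iff.1 x.2.2
    have h2 : ((y.2:ℕ):ℝ) ≤ b := by exact_mod_cast Nat.lt_succ_iff.1 y.2.2
    have h3 : (0:ℝ) ≤ ((x.2:ℕ):ℝ) := by positivity
    have h4 : (0:ℝ) ≤ ((y.2:ℕ):ℝ) := by positivity
    push_cast
    rw [abs_le]; constructor <;> linarith
  · rw [hC]; ring

lemma line_exists' {s t θ c c0 : ℝ} (hs : 0 ≤ s) (ht : 0 ≤ t) (hst : s + t = 1) (hc : c ≤ c0)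
    (hθ : 0 < s → ∀ q : ℕ, 0 < q → c0 ≤ (q:ℝ) ^ (1 / s) * dInt (q * θ)) {q : ℕ} (hq : 0 < q)
    (p r : ℤ) (hp : |q * θ - p| * (q:ℝ) ^ s < c) :
    ∃ A B C : ℤ, B ≠ 0 ∧ |(A:ℝ)| ≤ (q:ℝ) ^ s ∧ |(B:ℝ)| ≤ (q:ℝ) ^ t ∧
      A * p + B * r + C * q = 0 := by
  have hq0 : (0:ℝ) < q := by exact_mod_cast hq
  rcases hs.eq_or_lt with rfl | hs0
  · obtain rfl : t = 1 := by linarith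
    refine ⟨0, q, -r, by exact_mod_cast hq.ne', by simp, by simp, by ring⟩
  obtain ⟨A, B, C, hne, hA, hB, h⟩ := line_exists hs ht hst hq p r
  refine ⟨A, B, C, ?_, hA, hB, h⟩
  rintro rfl
  have hA0 : A ≠ 0 := by simpa using hne
  have hN : 0 < A.natAbs := Int.natAbs_pos.2 hA0
  have h1 := hθ hs0 A.natAbs hN
  have hNA : ((A.natAbs : ℕ) : ℝ) = |(A:ℝ)| := by rw [Nat.cast_natAbs]; simp
  rw [hNA] at h1
  have hApos : 0 < |(A:ℝ)| := by rw [← hNA]; exact_mod_cast hN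
  -- distance bound
  have h2 : dInt (|(A:ℝ)| * θ) ≤ |A * θ + C| := by
    rcases abs_choice (A:ℝ) with h' | h' <;> rw [h']
    · refine (dInt_le _ (-C)).trans_eq ?_
      push_cast; ring_nf
    · refine (dInt_le _ C).trans_eq ?_
      rw [← abs_neg]; congr 1; ring
  have h3 : |A * θ + C| * q = |(A:ℝ)| * |q * θ - p| := by
    have hr : (A:ℝ) * p + C * q = 0 := by exact_mod_cast (by simpa using h)
    rw [← abs_of_pos hq0, ← abs_mul, ← abs_mul, abs_of_pos hq0]
    congr 1; linear_combination hr
  have h4 : |(A:ℝ)| ^ (1 / s) ≤ q := by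
    calc |(A:ℝ)| ^ (1 / s) ≤ ((q:ℝ) ^ s) ^ (1/s) := by gcongr
      _ = q := by rw [← Real.rpow_mul hq0.le, mul_one_div_cancel hs0.ne', Real.rpow_one]
  have h5 : |(A:ℝ)| ^ (1 / s) * dInt (|(A:ℝ)| * θ) ≤ |A * θ + C| * q := by
    rw [mul_comm (|A * θ + C|)]
    exact mul_le_mul h4 h2 (dInt_nonneg _) hq0.le
  have h6 : |(A:ℝ)| * |q * θ - p| ≤ |q * θ - p| * (q:ℝ) ^ s := by
    rw [mul_comm]; gcongr
  linarith

/-- A minimal dangerous point with a line through it in class `(n,i)`. -/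
structure Cls (s t θ c : ℝ) (R n i q : ℕ) (p r A B C : ℤ) (z : ℝ) : Prop where
  hq : 0 < q
  hp : |q * θ - p| * (q:ℝ) ^ s < c
  hr : |q * z - r| * (q:ℝ) ^ t < c
  hmin : ∀ q' < q, ¬ Dang s t θ c q' z
  hA : |(A:ℝ)| ≤ (q:ℝ) ^ s
  hB : |(B:ℝ)| ≤ (q:ℝ) ^ t
  hB0 : B ≠ 0
  hL : A * p + B * r + C * q = 0
  hH1 : (R:ℝ) ^ n ≤ q * |(B:ℝ)|
  hH2 : q * |(B:ℝ)| < (R:ℝ) ^ (n+1)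
  hx1 : 2 ^ i * (R:ℝ) ^ n ≤ (q:ℝ) * (q:ℝ) ^ t
  hx2 : (q:ℝ) * (q:ℝ) ^ t < 2 ^ (i+1) * (R:ℝ) ^ n

namespace Cls

variable {s t θ c : ℝ} {R n i q q' : ℕ} {p r A B C p' r' A' B' C' : ℤ} {z z' : ℝ}

lemma q_one (h : Cls s t θ c R n i q p r A B C z) : (1:ℝ) ≤ q := by exact_mod_cast h.hq

lemma q_lt (ht : 0 ≤ t) (h : Cls s t θ c R n i q p r A B C z)
    (h' : Cls s t θ c R n i q' p' r' A' B' C' z') : (q':ℝ) < 2 * q := by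
  by_contra hcon
  push Not at hcon
  have h1 := h.q_one
  have h3 : (q:ℝ) ^ t ≤ (q':ℝ) ^ t := Real.rpow_le_rpow (by positivity) (by linarith) ht
  have h2 := h'.hx2
  have h4 := h.hx1
  have h5 : 2 * q * (q:ℝ) ^ t ≤ (q':ℝ) * (q':ℝ) ^ t := by gcongr
  rw [pow_succ] at h2
  linarith

lemma lin (h : Cls s t θ c R n i q p r A B C z) : |A * θ + B * z + C| * q ≤ 2 * c := by
  have hq0 : (0:ℝ) < q := by linarith [h.q_one]
  have hl : (A:ℝ) * p + B * r + C * q = 0 := by exact_mod_cast h.hL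
  have e : |A * θ + B * z + C| * q = |A * (q * θ - p) + B * (q * z - r)| := by
    have : |A * θ + B * z + C| * q = |(A * θ + B * z + C) * q| := by rw [abs_mul, abs_of_pos hq0]
    rw [this]
    congr 1; linear_combination hl
  rw [e]
  refine (abs_add_le _ _).trans ?_
  rw [abs_mul, abs_mul]
  have h1 : |(A:ℝ)| * |q * θ - p| ≤ |q * θ - p| * (q:ℝ) ^ s := by
    rw [mul_comm]; have := h.hA; gcongr
  have h2 : |(B:ℝ)| * |q * z - r| ≤ |q * z - r| * (q:ℝ) ^ t := by
    rw [mul_comm]; have := h.hB; gcongr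
  linarith [h.hp, h.hr]

lemma near (h : Cls s t θ c R n i q p r A B C z) (hR : 0 < R) :
    |z - (-(A * θ + C) / B)| ≤ 2 * c / R ^ n := by
  have hq0 : (0:ℝ) < q := by linarith [h.q_one]
  have hB0 : (B:ℝ) ≠ 0 := by exact_mod_cast h.hB0
  have hB : 0 < |(B:ℝ)| := abs_pos.2 hB0
  have hRn : (0:ℝ) < (R:ℝ) ^ n := by positivity
  have e : |z - (-(A * θ + C) / B)| * |(B:ℝ)| = |A * θ + B * z + C| := by
    rw [← abs_mul]; congr 1; field_simp; ring
  have h1 := h.lin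
  rw [← e] at h1
  rw [le_div_iff₀ hRn]
  refine le_trans ?_ h1
  rw [mul_assoc]
  refine mul_le_mul_of_nonneg_left ?_ (abs_nonneg _)
  linarith [h.hH1]

lemma cross (ht : 0 ≤ t) (hs : 0 ≤ s) (ht1 : t ≤ 1) (hs1 : s ≤ 1) {δ : ℝ} (hR : 0 < R)
    (hδ : |z - z'| ≤ δ) (hsm : 8 * c + 2 * (R:ℝ) ^ (n+1) * δ < 1) (hc : 0 < c)
    (h : Cls s t θ c R n i q p r A B C z)
    (h' : Cls s t θ c R n i q' p' r' A' B' C' z') : A * p' + B * r' + C * q' = 0 := by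
  have hq := h.q_one
  have hq' := h'.q_one
  have h1 := q_lt ht h h'
  have h2 := q_lt ht h' h
  have e : ((A * p' + B * r' + C * q' : ℤ):ℝ) = q' * (A * θ + B * z + C) - A * (q' * θ - p')
      - B * (q' * z' - r') + B * q' * (z' - z) := by push_cast; ring
  have b1 : |q' * (A * θ + B * z + C)| ≤ 4 * c := by
    rw [abs_mul, abs_of_pos (by linarith)]
    have := h.lin
    nlinarith [abs_nonneg (A * θ + B * z + C)]
  have two_rpow : ∀ e : ℝ, 0 ≤ e → e ≤ 1 → (q:ℝ) ^ e ≤ 2 * (q':ℝ) ^ e := by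
    intro e he he1
    calc (q:ℝ) ^ e ≤ (2 * q') ^ e := Real.rpow_le_rpow (by linarith) (by linarith) he
      _ = 2 ^ e * (q':ℝ) ^ e := Real.mul_rpow (by norm_num) (by linarith)
      _ ≤ 2 ^ (1:ℝ) * (q':ℝ) ^ e := by gcongr; norm_num
      _ = _ := by simp
  have b2 : |A * (q' * θ - p')| ≤ 2 * c := by
    rw [abs_mul]
    calc |(A:ℝ)| * |q' * θ - p'| ≤ 2 * (q':ℝ) ^ s * |q' * θ - p'| := by
          gcongr; exact h.hA.trans (two_rpow s hs hs1)
      _ = 2 * (|q' * θ - p'| * (q':ℝ) ^ s) := by ring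
      _ ≤ _ := by linarith [h'.hp]
  have b3 : |B * (q' * z' - r')| ≤ 2 * c := by
    rw [abs_mul]
    calc |(B:ℝ)| * |q' * z' - r'| ≤ 2 * (q':ℝ) ^ t * |q' * z' - r'| := by
          gcongr; exact h.hB.trans (two_rpow t ht ht1)
      _ = 2 * (|q' * z' - r'| * (q':ℝ) ^ t) := by ring
      _ ≤ _ := by linarith [h'.hr]
  have b4 : |B * q' * (z' - z)| ≤ 2 * (R:ℝ) ^ (n+1) * δ := by
    rw [abs_mul, abs_mul, abs_of_pos (show (0:ℝ) < q' by linarith), abs_sub_comm z' z]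
    have := h.hH2
    have hb : |(B:ℝ)| * q' ≤ 2 * (R:ℝ) ^ (n+1) := by nlinarith [abs_nonneg (B:ℝ)]
    exact mul_le_mul hb hδ (abs_nonneg _) (by positivity)
  have : |((A * p' + B * r' + C * q' : ℤ):ℝ)| < 1 := by
    rw [e]
    refine lt_of_le_of_lt ?_ hsm
    refine (abs_add_le _ _).trans ?_
    have := abs_sub (q' * (A * θ + B * z + C) - A * (q' * θ - p')) (B * (q' * z' - r'))
    have := abs_sub (q' * (A * θ + B * z + C)) (A * (q' * θ - p'))
    linarith
  rw [← Int.cast_abs] at this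
  have : |A * p' + B * r' + C * q'| < 1 := by exact_mod_cast this
  exact Int.abs_lt_one_iff.1 this

lemma prop_le (ht : 0 ≤ t) (h : Cls s t θ c R n i q p r A B C z)
    (h' : Cls s t θ c R n i q' p' r' A' B' C' z')
    (e2 : (q:ℤ) * r' = q' * r) : q' ≤ q := by
  by_contra hcon
  push Not at hcon
  refine h'.hmin q hcon ⟨h.hq, p, r, h.hp, ?_⟩
  have hq := h.q_one
  have hq' := h'.q_one
  have hlt : (q:ℝ) < q' := by exact_mod_cast hcon
  refine lt_of_le_of_lt ?_ h'.hr
  have e2' : (q:ℝ) * r' = q' * r := by exact_mod_cast e2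
  have : |(q:ℝ) * z' - r| ≤ |q' * z' - r'| := by
    have e3 : |(q:ℝ) * z' - r| * q' = |q' * z' - r'| * q := by
      rw [← abs_of_pos (show (0:ℝ) < q' by linarith), ← abs_mul,
        abs_of_pos (show (0:ℝ) < q' by linarith), ← abs_of_pos (show (0:ℝ) < q by linarith), ← abs_mul,
        abs_of_pos (show (0:ℝ) < q by linarith)]
      congr 1; linear_combination e2'
    nlinarith [abs_nonneg ((q:ℝ) * z' - r), abs_nonneg ((q':ℝ) * z' - r')]
  gcongr

/-- Uniqueness of the line, first case. -/
lemma uniq1 (ht : 0 ≤ t) (hs : 0 ≤ s) (ht1 : t ≤ 1) (hs1 : s ≤ 1) {δ : ℝ} (hR : 0 < R)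
    (hδ : |z - z'| ≤ δ) (hsm : 8 * c + 2 * (R:ℝ) ^ (n+1) * δ < 1) (hc : 0 < c)
    (h : Cls s t θ c R n i q p r A B C z)
    (h' : Cls s t θ c R n i q' p' r' A' B' C' z')
    (hfun : q = q' → p = p' → r = r' → A = A' ∧ B = B' ∧ C = C') :
    A * B' = A' * B ∧ B * C' = B' * C := by
  have c1 := cross ht hs ht1 hs1 hR hδ hsm hc h h'
  have c2 := cross ht hs ht1 hs1 hR (by rwa [abs_sub_comm] at hδ) hsm hc h' h
  have l1 := h.hL
  have l2 := h'.hL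
  have hq : (q:ℤ) ≠ 0 := by exact_mod_cast h.hq.ne'
  have hq' : (q':ℤ) ≠ 0 := by exact_mod_cast h'.hq.ne'
  by_cases hD : A * B' - A' * B = 0
  · refine ⟨by linarith, ?_⟩
    have : (q:ℤ) * (B * C' - B' * C) = 0 := by linear_combination p * hD - B' * l1 + B * c2
    rcases mul_eq_zero.1 this with h0 | h0
    · exact absurd h0 hq
    · linarith
  · have e1 : (q:ℤ) * p' = q' * p := by
      apply mul_left_cancel₀ hD
      linear_combination q * (B' * c1 - B * l2) - q' * (B' * l1 - B * c2)
    have e2 : (q:ℤ) * r' = q' * r := by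
      apply mul_left_cancel₀ hD
      linear_combination -q * (A' * c1 - A * l2) + q' * (A' * l1 - A * c2)
    have g1 := prop_le ht h h' e2
    have g2 := prop_le ht h' h e2.symm
    obtain rfl : q = q' := le_antisymm g2 g1
    obtain rfl : p' = p := mul_left_cancel₀ hq e1
    obtain rfl : r' = r := mul_left_cancel₀ hq e2
    obtain ⟨rfl, rfl, rfl⟩ := hfun rfl rfl rfl
    constructor <;> ring

set_option maxHeartbeats 1000000 in
/-- Uniqueness of the line, second case. -/
lemma uniq2 (ht : 0 ≤ t) (hs : 0 ≤ s) (hst : s + t = 1) {δ : ℝ} {u : ℕ} (hR : 2 ≤ R)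
    (hδ : |z - z'| ≤ δ) (hδ2 : 4 * (R:ℝ) ^ (n+1) * δ ≤ R ^ u) (hc : 0 < c) (hc8 : 8 * c ≤ 1)
    (hu : 64 * (R:ℝ) ^ 2 * R ^ u ≤ c * ((2:ℝ) ^ i) ^ t)
    (h : Cls s t θ c R n i q p r A B C z)
    (h' : Cls s t θ c R n i q' p' r' A' B' C' z') :
    A * B' = A' * B ∧ B * C' = B' * C := by
  have hq := h.q_one
  have hq' := h'.q_one
  have h1 := q_lt ht h h'
  have h2 := q_lt ht h' h
  have hR2 : (2:ℝ) ≤ R := by exact_mod_cast hR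
  have hq0 : (0:ℝ) < q := by linarith
  set V : ℝ := (R:ℝ) ^ u with hV
  have hV1 : 1 ≤ V := one_le_pow₀ (by linarith)
  set N : ℝ := (R:ℝ) ^ n with hN
  have hN0 : 0 < N := by positivity
  have hRN : (R:ℝ) ^ (n+1) = R * N := by rw [pow_succ]; ring
  set a : ℝ := (q:ℝ) ^ s with ha
  set b : ℝ := (q:ℝ) ^ t with hb
  have ha1 : 0 < a := by positivity
  have hb1 : 0 < b := by positivity
  have hab : a * b = q := by rw [ha, hb, ← Real.rpow_add hq0, hst, Real.rpow_one]
  set x : ℝ := q * b / N with hx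
  have hxN : x * N = q * b := by rw [hx]; field_simp
  have hxi : 2 ^ i ≤ x := by rw [hx, le_div_iff₀ hN0]; exact h.hx1
  have hi1 : (1:ℝ) ≤ 2 ^ i := one_le_pow₀ (by norm_num)
  have hx1 : 1 ≤ x := hi1.trans hxi
  have hxt : ((2:ℝ) ^ i) ^ t ≤ x ^ t := Real.rpow_le_rpow (by positivity) hxi ht
  have hxt1 : x ^ t ≤ x := by
    calc x ^ t ≤ x ^ (1:ℝ) := Real.rpow_le_rpow_of_exponent_le hx1 (by linarith)
      _ = x := Real.rpow_one x
  have hxtpos : 0 < x ^ t := by positivity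
  have hu2 : 64 * (R:ℝ) ^ 2 * V ≤ c * x ^ t := hu.trans (by gcongr)
  have hRV : (R:ℝ) ≤ R * V := le_mul_of_one_le_right (by linarith) hV1
  have hR2V : 2 * (R * V) ≤ (R:ℝ) ^ 2 * V := by
    have := mul_le_mul_of_nonneg_right hR2 (show 0 ≤ R * V by linarith)
    linarith [show (R:ℝ) * (R * V) = (R:ℝ) ^ 2 * V by ring]
  have hcx : c * x ^ t ≤ c * x := mul_le_mul_of_nonneg_left hxt1 hc.le
  have hcx1 : c * x ≤ x := mul_le_of_le_one_left (by linarith) (by linarith)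
  have hx8 : 8 * R < x := by linarith
  -- bounds
  have bA' : |(A':ℝ)| ≤ 2 * a := by
    refine h'.hA.trans ?_
    calc (q':ℝ) ^ s ≤ (2 * q) ^ s := Real.rpow_le_rpow (by linarith) (by linarith) hs
      _ = 2 ^ s * (q:ℝ) ^ s := Real.mul_rpow (by norm_num) (by linarith)
      _ ≤ 2 ^ (1:ℝ) * (q:ℝ) ^ s := by gcongr; norm_num; linarith
      _ = _ := by simp [ha]
  have bA : |(A:ℝ)| ≤ 2 * a := by have := h.hA; linarith
  have bB : |(B:ℝ)| ≤ 2 * (R * N) / q := by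
    rw [le_div_iff₀ hq0]; have := h.hH2; rw [hRN] at this; linarith [mul_pos (show (0:ℝ) < R by linarith) hN0]
  have bB' : |(B':ℝ)| ≤ 2 * (R * N) / q := by
    rw [le_div_iff₀ hq0]; have := h'.hH2; rw [hRN] at this
    linarith [mul_le_mul_of_nonneg_left h2.le (abs_nonneg (B':ℝ))]
  have bL : |A * θ + B * z + C| ≤ V / q := by
    rw [le_div_iff₀ hq0]; have := h.lin; linarith
  have bL' : |A' * θ + B' * z + C'| ≤ V / q := by
    rw [le_div_iff₀ hq0]
    have e : A' * θ + B' * z + C' = (A' * θ + B' * z' + C') + B' * (z - z') := by ring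
    have k1 : |A' * θ + B' * z' + C'| * q ≤ 4 * c := by
      have := h'.lin
      linarith [mul_le_mul_of_nonneg_left h2.le (abs_nonneg (A' * θ + B' * z' + C'))]
    have k2 : |B' * (z - z')| * q ≤ V / 2 := by
      rw [abs_mul]
      have : |(B':ℝ)| * q ≤ 2 * (R * N) := by rwa [le_div_iff₀ hq0] at bB'
      have := mul_le_mul this hδ (abs_nonneg _) (by positivity)
      rw [hRN] at hδ2
      linarith
    rw [e]
    have := mul_le_mul_of_nonneg_right (abs_add_le (A' * θ + B' * z' + C') (B' * (z - z'))) hq0.le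
    linarith
  set D0 : ℤ := A * B' - A' * B with hD0
  set D1 : ℤ := B * C' - B' * C with hD1
  set D2 : ℤ := C * A' - C' * A with hD2
  have d0 : |(D0:ℝ)| ≤ 8 * R / x * q := by
    have e : 8 * R / x * q = 2 * (2 * a * (2 * (R * N) / q)) := by
      have : N = q * b / x := by rw [eq_div_iff (by linarith)]; linarith
      rw [this]; field_simp; rw [← hab]; ring
    rw [e, hD0]
    push_cast
    have k1 : |(A:ℝ) * B'| ≤ 2 * a * (2 * (R * N) / q) := by
      rw [abs_mul]; exact mul_le_mul bA bB' (abs_nonneg _) (by positivity)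
    have k2 : |(A':ℝ) * B| ≤ 2 * a * (2 * (R * N) / q) := by
      rw [abs_mul]; exact mul_le_mul bA' bB (abs_nonneg _) (by positivity)
    have := abs_sub ((A:ℝ) * B') (A' * B)
    linarith
  have d1 : |D0 * θ - D1| ≤ 4 * R * V / (x * a) := by
    have e : 4 * R * V / (x * a) = 2 * ((2 * (R * N) / q) * (V / q)) := by
      have : N = q * b / x := by rw [eq_div_iff (by linarith)]; linarith
      rw [this]; field_simp; rw [← hab]; ring
    have e2 : (D0:ℝ) * θ - D1 = B' * (A * θ + B * z + C) - B * (A' * θ + B' * z + C') := by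
      rw [hD0, hD1]; push_cast; ring
    rw [e, e2]
    have k1 : |B' * (A * θ + B * z + C)| ≤ (2 * (R * N) / q) * (V / q) := by
      rw [abs_mul]; exact mul_le_mul bB' bL (abs_nonneg _) (by positivity)
    have k2 : |B * (A' * θ + B' * z + C')| ≤ (2 * (R * N) / q) * (V / q) := by
      rw [abs_mul]; exact mul_le_mul bB bL' (abs_nonneg _) (by positivity)
    have := abs_sub (B' * (A * θ + B * z + C)) (B * (A' * θ + B' * z + C'))
    linarith
  have d2 : |D0 * z - D2| ≤ 4 * V / b := by
    have e : 4 * V / b = 2 * (2 * a * (V / q)) := by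
      field_simp; rw [← hab]; ring
    have e2 : (D0:ℝ) * z - D2 = A * (A' * θ + B' * z + C') - A' * (A * θ + B * z + C) := by
      rw [hD0, hD2]; push_cast; ring
    rw [e, e2]
    have k1 : |A * (A' * θ + B' * z + C')| ≤ 2 * a * (V / q) := by
      rw [abs_mul]; exact mul_le_mul bA bL' (abs_nonneg _) (by positivity)
    have k2 : |A' * (A * θ + B * z + C)| ≤ 2 * a * (V / q) := by
      rw [abs_mul]; exact mul_le_mul bA' bL (abs_nonneg _) (by positivity)
    have := abs_sub (A * (A' * θ + B' * z + C')) (A' * (A * θ + B * z + C))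
    linarith
  have f1 : 4 * R * V / x < c := by
    rw [div_lt_iff₀ (by linarith)]; linarith
  have f2 : 32 * R * V / x ^ t < c := by
    rw [div_lt_iff₀ hxtpos]; linarith
  have hD0z : D0 = 0 := by
    by_contra hne
    have hQ : ((D0.natAbs : ℕ) : ℝ) = |(D0:ℝ)| := by rw [Nat.cast_natAbs]; simp
    have hpos : 0 < D0.natAbs := Int.natAbs_pos.2 hne
    have hlt : D0.natAbs < q := by
      have : ((D0.natAbs : ℕ) : ℝ) < q := by
        rw [hQ]
        refine lt_of_le_of_lt d0 ?_
        have : 8 * R / x < 1 := by rw [div_lt_one (by linarith)]; exact hx8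
        exact mul_lt_of_lt_one_left hq0 this
      exact_mod_cast this
    have k1 : |D0 * θ - D1| * |(D0:ℝ)| ^ s < c := by
      have : |(D0:ℝ)| ^ s ≤ a := by
        refine Real.rpow_le_rpow (abs_nonneg _) ?_ hs
        rw [← hQ]; exact_mod_cast hlt.le
      calc |D0 * θ - D1| * |(D0:ℝ)| ^ s ≤ 4 * R * V / (x * a) * a := by gcongr
        _ = 4 * R * V / x := by field_simp
        _ < c := f1
    have k2 : |D0 * z - D2| * |(D0:ℝ)| ^ t < c := by
      have h8 : (8 * (R:ℝ)) ^ t ≤ 8 * R := by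
        calc (8 * (R:ℝ)) ^ t ≤ (8 * (R:ℝ)) ^ (1:ℝ) :=
              Real.rpow_le_rpow_of_exponent_le (by linarith) (by linarith)
          _ = _ := Real.rpow_one _
      have : |(D0:ℝ)| ^ t ≤ 8 * R / x ^ t * b := by
        calc |(D0:ℝ)| ^ t ≤ (8 * R / x * q) ^ t := Real.rpow_le_rpow (abs_nonneg _) d0 ht
          _ = (8 * R) ^ t / x ^ t * b := by
            rw [Real.mul_rpow (by positivity) hq0.le, Real.div_rpow (by positivity) (by linarith)]
          _ ≤ _ := by gcongr
      calc |D0 * z - D2| * |(D0:ℝ)| ^ t ≤ 4 * V / b * (8 * R / x ^ t * b) := by gcongr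
        _ = 32 * R * V / x ^ t := by field_simp; ring
        _ < c := f2
    refine h.hmin D0.natAbs hlt ⟨hpos, ?_⟩
    rw [hQ]
    rcases abs_choice (D0:ℝ) with h' | h'
    · refine ⟨D1, D2, ?_, ?_⟩
      · rw [h'] at k1 ⊢; exact k1
      · rw [h'] at k2 ⊢; exact k2
    · refine ⟨-D1, -D2, ?_, ?_⟩
      · have : |D0 * θ - D1| = |(-D0 : ℝ) * θ - ((-D1 : ℤ):ℝ)| := by
          rw [← abs_neg]; congr 1; push_cast; ring
        rw [this] at k1
        rw [h'] at k1 ⊢; exact k1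
      · have : |D0 * z - D2| = |(-D0 : ℝ) * z - ((-D2 : ℤ):ℝ)| := by
          rw [← abs_neg]; congr 1; push_cast; ring
        rw [this] at k2
        rw [h'] at k2 ⊢; exact k2
  have hD1z : D1 = 0 := by
    rw [hD0z] at d1
    have ha1' : 1 ≤ a := Real.one_le_rpow hq hs
    have : |(D1:ℝ)| < 1 := by
      have e : |(D1:ℝ)| = |((0:ℤ):ℝ) * θ - D1| := by simp
      rw [e]
      refine lt_of_le_of_lt d1 ?_
      have : 4 * R * V / (x * a) ≤ 4 * R * V / x := by
        gcongr; exact le_mul_of_one_le_right (by linarith) ha1'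
      linarith
    rw [← Int.cast_abs] at this
    have : |D1| < 1 := by exact_mod_cast this
    exact Int.abs_lt_one_iff.1 this
  constructor <;> linarith

end Cls


/-- Potential. -/
noncomputable def meetsP (a L : ℝ) (R : ℕ) (m j : ℕ) (y ρ : ℝ) : Prop :=
  y - ρ < a + (j + 1) * (L / R ^ m) ∧ a + j * (L / R ^ m) < y + ρ

open Classical in
noncomputable def potP {ι : Type} (a L : ℝ) (R : ℕ) (d : ℝ) (y : ℕ → ℕ → ι → ℝ) (ρ : ℕ → ι → ℝ)
    (M m j : ℕ) (anc : ℕ → ℕ) : ℝ≥0∞ :=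
  ∑ m' ∈ Finset.range M, ∑' i, if meetsP a L R m j (y m' (anc m') i) (ρ m' i) then
    ENNReal.ofReal (ρ m' i ^ d) else 0

lemma count_le_two (T : Finset ℕ) (h : ∀ r₁ ∈ T, ∀ r₂ ∈ T, r₂ ≤ r₁ + 1) : T.card ≤ 2 := by
  rcases T.eq_empty_or_nonempty with rfl | hne
  · simp
  · have : T ⊆ Finset.Icc (T.min' hne) (T.min' hne + 1) := by
      intro r hr
      exact Finset.mem_Icc.2 ⟨T.min'_le r hr, h _ (T.min'_mem hne) _ hr⟩
    refine (Finset.card_le_card this).trans ?_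
    simp; omega

lemma meets_child {a L : ℝ} (hL : 0 < L) {R : ℕ} (hR : 2 ≤ R) {m j r : ℕ} (hr : r < R) {y ρ : ℝ}
    (h : meetsP a L R (m+1) (j * R + r) y ρ) : meetsP a L R m j y ρ := by
  have hR0 : (0:ℝ) < R := by positivity
  have hl : L / R ^ m = R * (L / R ^ (m+1)) := by rw [pow_succ]; field_simp
  have hl0 : 0 < L / (R:ℝ) ^ (m+1) := by positivity
  unfold meetsP at *
  rw [hl]
  generalize L / (R:ℝ) ^ (m+1) = l at *
  push_cast at h
  have hr' : (r:ℝ) + 1 ≤ R := by exact_mod_cast hr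
  have h0 : (0:ℝ) ≤ r := by positivity
  constructor <;> nlinarith

lemma meets_count {a L : ℝ} (hL : 0 < L) {R : ℕ} (hR : 2 ≤ R) {m j r₁ r₂ : ℕ} {y ρ : ℝ}
    (hρ : 2 * ρ < L / R ^ (m+1))
    (h1 : meetsP a L R (m+1) (j * R + r₁) y ρ) (h2 : meetsP a L R (m+1) (j * R + r₂) y ρ) :
    r₂ ≤ r₁ + 1 := by
  have hR0 : (0:ℝ) < R := by positivity
  have hl0 : 0 < L / (R:ℝ) ^ (m+1) := by positivity
  unfold meetsP at *
  generalize L / (R:ℝ) ^ (m+1) = l at *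
  push_cast at h1 h2
  have : (r₂ : ℝ) < r₁ + 2 := by
    by_contra hc
    push Not at hc
    nlinarith
  have : r₂ < r₁ + 2 := by exact_mod_cast this
  omega

theorem pot_step {ι : Type} (a L : ℝ) (hL : 0 < L) (R : ℕ) (hR : 2 ≤ R) (d : ℝ) (hd : 0 < d)
    (hRd : 4 * (R:ℝ) ^ d ≤ R)
    (y : ℕ → ℕ → ι → ℝ) (ρ : ℕ → ι → ℝ) (hρ : ∀ m i, 0 < ρ m i)
    (hsum : ∀ m, ∑' i, ENNReal.ofReal (ρ m i ^ d) ≤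
      ENNReal.ofReal (1 / 2 * ((1 / (4 * R)) ^ d * (L / R ^ m) ^ d)))
    (m j : ℕ) (anc : ℕ → ℕ)
    (hpot : potP a L R d y ρ (m+1) m j anc ≤ ENNReal.ofReal ((1 / (4 * R)) ^ d * (L / R ^ m) ^ d)) :
    ∃ r < R, potP a L R d y ρ (m+2) (m+1) (j*R+r) (Function.update anc (m+1) (j*R+r)) ≤
      ENNReal.ofReal ((1 / (4 * R)) ^ d * (L / R ^ (m+1)) ^ d) := by
  classical
  have hR0 : (0:ℝ) < R := by positivity
  have hl0 : 0 < L / (R:ℝ) ^ (m+1) := by positivity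
  set S : ℕ → ℝ≥0∞ := fun r => potP a L R d y ρ (m+1) (m+1) (j*R+r) anc with hS
  have hsumS : ∑ r ∈ Finset.range R, S r ≤ 2 * potP a L R d y ρ (m+1) m j anc := by
    simp only [hS]
    unfold potP
    rw [Finset.sum_comm, Finset.mul_sum]
    refine Finset.sum_le_sum fun m' hm' => ?_
    rw [← Summable.tsum_finsetSum (fun _ _ => ENNReal.summable), ← ENNReal.tsum_mul_left]
    refine ENNReal.tsum_le_tsum fun i => ?_
    by_cases hmeet : meetsP a L R m j (y m' (anc m') i) (ρ m' i)
    · rw [if_pos hmeet]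
      have hle : ENNReal.ofReal (ρ m' i ^ d) ≤
          ENNReal.ofReal ((1 / (4 * R)) ^ d * (L / R ^ m) ^ d) := by
        refine le_trans ?_ hpot
        unfold potP
        refine le_trans ?_ (Finset.single_le_sum (f := fun m' => ∑' i, if meetsP a L R m j (y m' (anc m') i) (ρ m' i) then ENNReal.ofReal (ρ m' i ^ d) else 0) (fun _ _ => zero_le) hm')
        refine le_trans ?_ (ENNReal.le_tsum i)
        rw [if_pos hmeet]
      rw [ENNReal.ofReal_le_ofReal_iff (by positivity),
        ← Real.mul_rpow (by positivity) (by positivity)] at hle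
      have hle2 := (Real.rpow_le_rpow_iff (hρ m' i).le (by positivity) hd).1 hle
      have hl : L / R ^ m = R * (L / R ^ (m+1)) := by rw [pow_succ]; field_simp
      have h4 : 1 / (4 * (R:ℝ)) * (L / R ^ m) = (L / R ^ (m+1)) / 4 := by
        rw [hl]; field_simp
      rw [h4] at hle2
      rw [← Finset.sum_filter, Finset.sum_const, nsmul_eq_mul]
      gcongr
      have := count_le_two ((Finset.range R).filter fun r => meetsP a L R (m+1) (j*R+r) (y m' (anc m') i) (ρ m' i)) (by
        intro r₁ h1 r₂ h2
        simp only [Finset.mem_filter] at h1 h2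
        exact meets_count hL hR (by linarith) h1.2 h2.2)
      exact_mod_cast this
    · rw [if_neg hmeet]
      refine le_of_eq_of_le (Finset.sum_eq_zero fun r hr => ?_) zero_le
      rw [if_neg]
      intro h
      exact hmeet (meets_child hL hR (Finset.mem_range.1 hr) h)
  obtain ⟨r, hr, hmin⟩ := Finset.exists_min_image (Finset.range R) S ⟨0, by simp; omega⟩
  refine ⟨r, Finset.mem_range.1 hr, ?_⟩
  have hSr : S r ≤ ENNReal.ofReal (1 / 2 * ((1 / (4 * R)) ^ d * (L / R ^ (m+1)) ^ d)) := by
    have h1 := Finset.card_nsmul_le_sum (Finset.range R) S (S r) hmin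
    rw [Finset.card_range, nsmul_eq_mul] at h1
    have h2 := (h1.trans hsumS).trans (mul_le_mul_right hpot 2)
    have h3 : (2:ℝ≥0∞) * ENNReal.ofReal ((1 / (4 * R)) ^ d * (L / R ^ m) ^ d) ≤
        R * ENNReal.ofReal (1 / 2 * ((1 / (4 * R)) ^ d * (L / R ^ (m+1)) ^ d)) := by
      rw [← ENNReal.ofReal_natCast R, ← ENNReal.ofReal_mul (by positivity),
        show (2:ℝ≥0∞) = ENNReal.ofReal 2 by simp, ← ENNReal.ofReal_mul (by positivity)]
      apply ENNReal.ofReal_le_ofReal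
      have hl : L / R ^ m = R * (L / R ^ (m+1)) := by rw [pow_succ]; field_simp
      rw [hl, Real.mul_rpow (by positivity) (by positivity)]
      have : 0 ≤ (1 / (4 * (R:ℝ))) ^ d * (L / (R:ℝ) ^ (m+1)) ^ d := by positivity
      nlinarith
    have h4 := h2.trans h3
    rwa [ENNReal.mul_le_mul_iff_right (by simp; omega) (by simp)] at h4
  have hnew : potP a L R d y ρ (m+2) (m+1) (j*R+r) (Function.update anc (m+1) (j*R+r)) ≤
      S r + ∑' i, ENNReal.ofReal (ρ (m+1) i ^ d) := by
    simp only [hS]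
    unfold potP
    rw [Finset.sum_range_succ _ (m+1)]
    gcongr with m' hm' i
    · have : m' ≠ m + 1 := by have := Finset.mem_range.1 hm'; omega
      rw [Function.update_of_ne this]
    · split_ifs <;> simp
  refine (hnew.trans (add_le_add hSr (hsum (m+1)))).trans ?_
  rw [← ENNReal.ofReal_add (by positivity) (by positivity)]
  apply ENNReal.ofReal_le_ofReal
  linarith

theorem noncover {ι : Type} (a L : ℝ) (hL : 0 < L) (R : ℕ) (hR : 2 ≤ R) (d : ℝ) (hd : 0 < d)
    (hRd : 4 * (R:ℝ) ^ d ≤ R)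
    (y : ℕ → ℕ → ι → ℝ) (ρ : ℕ → ι → ℝ) (hρ : ∀ m i, 0 < ρ m i)
    (hsum : ∀ m, ∑' i, ENNReal.ofReal (ρ m i ^ d) ≤
      ENNReal.ofReal (1 / 2 * ((1 / (4 * R)) ^ d * (L / R ^ m) ^ d))) :
    ∃ (z : ℝ) (j : ℕ → ℕ), j 0 = 0 ∧
      (∀ m, a + j m * (L / R ^ m) ≤ z ∧ z ≤ a + (j m + 1) * (L / R ^ m)) ∧
      ∀ m i, ρ m i ≤ |z - y m (j m) i| := by
  classical
  have hR0 : (0:ℝ) < R := by positivity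
  -- states
  let P : ℕ → ℕ × (ℕ → ℕ) → Prop := fun m st =>
    potP a L R d y ρ (m+1) m st.1 st.2 ≤ ENNReal.ofReal ((1 / (4 * R)) ^ d * (L / R ^ m) ^ d)
      ∧ st.2 m = st.1
  have hstep : ∀ m st, P m st → ∃ r < R, P (m+1) (st.1 * R + r, Function.update st.2 (m+1) (st.1*R+r)) := by
    rintro m ⟨j, anc⟩ ⟨h, h'⟩
    obtain ⟨r, hr, h2⟩ := pot_step a L hL R hR d hd hRd y ρ hρ hsum m j anc h
    exact ⟨r, hr, h2, by simp⟩
  have h0 : P 0 (0, fun _ => 0) := by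
    refine ⟨?_, rfl⟩
    unfold potP
    simp only [zero_add, Finset.range_one, Finset.sum_singleton]
    refine le_trans (ENNReal.tsum_le_tsum fun i => ?_) ((hsum 0).trans ?_)
    · split_ifs <;> simp
    · apply ENNReal.ofReal_le_ofReal
      have : 0 ≤ (1 / (4 * (R:ℝ))) ^ d * (L / (R:ℝ) ^ 0) ^ d := by positivity
      linarith
  choose! f hf hfP using hstep
  let st : ℕ → ℕ × (ℕ → ℕ) := fun m => Nat.rec (0, fun _ => 0)
    (fun m s => (s.1 * R + f m s, Function.update s.2 (m+1) (s.1 * R + f m s))) m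
  have hst : ∀ m, st (m+1) = ((st m).1 * R + f m (st m),
    Function.update (st m).2 (m+1) ((st m).1 * R + f m (st m))) := fun m => rfl
  have hP : ∀ m, P m (st m) := by
    intro m
    induction m with
    | zero => exact h0
    | succ m ih => rw [hst]; exact hfP m _ ih
  have hanc : ∀ m m', m' ≤ m → (st m).2 m' = (st m').1 := by
    intro m
    induction m with
    | zero => intro m' h; obtain rfl : m' = 0 := by omega
              exact (hP 0).2
    | succ m ih =>
      intro m' h
      rcases Nat.lt_or_ge m' (m+1) with h1 | h1
      · rw [hst]; simp only
        rw [Function.update_of_ne (by omega)]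
        exact ih m' (by omega)
      · obtain rfl : m' = m + 1 := by omega
        exact (hP (m+1)).2
  set j : ℕ → ℕ := fun m => (st m).1 with hj
  have hjs : ∀ m, ∃ r < R, j (m+1) = j m * R + r := fun m => ⟨f m (st m), hf m _ (hP m), by simp [hj, hst]⟩
  have hanti : Antitone fun m => Set.Icc (a + j m * (L / R ^ m)) (a + (j m + 1) * (L / R ^ m)) := by
    refine antitone_nat_of_succ_le fun m => ?_
    obtain ⟨r, hr, h⟩ := hjs m
    have hl : L / R ^ m = R * (L / R ^ (m+1)) := by rw [pow_succ]; field_simp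
    have hl0 : 0 < L / (R:ℝ) ^ (m+1) := by positivity
    have hr' : (r:ℝ) + 1 ≤ R := by exact_mod_cast hr
    have h0 : (0:ℝ) ≤ r := by positivity
    rw [h, hl]
    push_cast
    generalize L / (R:ℝ) ^ (m+1) = l at *
    apply Set.Icc_subset_Icc <;> nlinarith
  have hz := ciSup_mem_iInter_Icc_of_antitone_Icc hanti (fun m => by
    have hl0 : 0 < L / (R:ℝ) ^ m := by positivity
    nlinarith)
  set z := ⨆ m, (a + j m * (L / (R:ℝ) ^ m)) with hzdef
  rw [Set.mem_iInter] at hz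
  refine ⟨z, j, rfl, fun m => hz m, fun m i => ?_⟩
  by_contra hc
  push Not at hc
  obtain ⟨hc1, hc2⟩ := abs_lt.1 hc
  have hw : ∀ m', m ≤ m' → ρ m i ≤ 1 / (4 * R) * (L / R ^ m') := by
    intro m' hm
    have hle : ENNReal.ofReal (ρ m i ^ d) ≤ ENNReal.ofReal ((1 / (4 * R)) ^ d * (L / R ^ m') ^ d) := by
      refine le_trans ?_ (hP m').1
      unfold potP
      refine le_trans ?_ (Finset.single_le_sum (f := fun m => ∑' i, if meetsP a L R m' (st m').1 (y m ((st m').2 m) i) (ρ m i) then ENNReal.ofReal (ρ m i ^ d) else 0) (fun _ _ => zero_le) (Finset.mem_range.2 (Nat.lt_succ_of_le hm)))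
      refine le_trans ?_ (ENNReal.le_tsum i)
      rw [if_pos]
      rw [hanc m' m hm]
      have := hz m'
      simp only [Set.mem_Icc] at this
      unfold meetsP
      constructor
      · have := this.2
        simp only [hj] at this hc1 hc2 ⊢; linarith
      · have := this.1
        simp only [hj] at this hc1 hc2 ⊢; linarith
    rw [ENNReal.ofReal_le_ofReal_iff (by positivity),
        ← Real.mul_rpow (by positivity) (by positivity)] at hle
    exact (Real.rpow_le_rpow_iff (hρ m i).le (by positivity) hd).1 hle
  have hlim : Filter.Tendsto (fun m' : ℕ => 1 / (4 * (R:ℝ)) * (L / R ^ m')) Filter.atTop (nhds 0) := by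
    have : Filter.Tendsto (fun m' : ℕ => 1 / (4 * (R:ℝ)) * (L * ((1 / (R:ℝ)) ^ m'))) Filter.atTop (nhds (1 / (4 * (R:ℝ)) * (L * 0))) := by
      refine Filter.Tendsto.const_mul _ (Filter.Tendsto.const_mul _ ?_)
      apply tendsto_pow_atTop_nhds_zero_of_lt_one (by positivity)
      rw [div_lt_one hR0]
      exact_mod_cast (by omega : 1 < R)
    simpa [div_eq_mul_inv] using this
  have := ge_of_tendsto hlim (Filter.eventually_atTop.2 ⟨m, fun m' h => hw m' h⟩)
  linarith [hρ m i]

lemma hasSum_half (E : ℝ) : HasSum (fun n : ℕ => E * (1 / 2) ^ (n + 1)) E := by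
  have h := (hasSum_geometric_two).mul_left (E / 2)
  have e1 : (fun n : ℕ => E * (1 / 2 : ℝ) ^ (n + 1)) = fun n : ℕ => E / 2 * (1 / 2 : ℝ) ^ n := by
    funext n; rw [pow_succ]; ring
  have e2 : E / 2 * 2 = E := by ring
  rw [e1]; rwa [e2] at h

def Removable (a L : ℝ) (R : ℕ) (d : ℝ) (S : Set ℝ) : Prop :=
  ∀ ε : ℝ, 0 < ε → ∃ (y : ℕ → ℕ → ℕ → ℝ) (ρ : ℕ → ℕ → ℝ), (∀ m i, 0 < ρ m i) ∧
    (∀ m, ∑' i, ENNReal.ofReal (ρ m i ^ d) ≤ ENNReal.ofReal (ε * (L / R ^ m) ^ d)) ∧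
    ∀ (z : ℝ) (j : ℕ → ℕ),
      (∀ m, a + j m * (L / R ^ m) ≤ z ∧ z ≤ a + (j m + 1) * (L / R ^ m)) →
      (∀ m i, ρ m i ≤ |z - y m (j m) i|) → z ∉ S

lemma choose_c {t d L ε c0 : ℝ} {R : ℕ} (hR : 2 ≤ R) (ht : 0 < t) (hd : 0 < d) (hL : 0 < L)
    (hε : 0 < ε) (hc0 : 0 < c0) :
    ∃ c : ℝ, 0 < c ∧ c ≤ c0 ∧ c ≤ 1 / 32 ∧ ∀ u : ℕ → ℕ,
      (∀ i : ℕ, c * ((2:ℝ) ^ i) ^ t / (64 * R ^ 2) ≤ (R:ℝ) ^ (u i + 1)) →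
      ∀ m : ℕ, ∑' i, ENNReal.ofReal ((3 * c / (R:ℝ) ^ (m + u i)) ^ d) ≤
        ENNReal.ofReal (ε * (L / R ^ m) ^ d) := by
  have hR0 : (0:ℝ) < R := by positivity
  have hR1 : (1:ℝ) ≤ R := by exact_mod_cast (by omega : 1 ≤ R)
  set g : ℝ := (2:ℝ) ^ (-(t * d / 2)) with hg
  have hg0 : 0 < g := by positivity
  have hg1 : g < 1 := Real.rpow_lt_one_of_one_lt_of_neg (by norm_num) (by
    have : 0 < t * d := by positivity
    linarith)
  set W : ℝ := (ε * L ^ d * (1 - g)) ^ (2 / d) with hW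
  have hW' : 0 < ε * L ^ d * (1 - g) := by
    have : 0 < 1 - g := by linarith
    positivity
  have hW0 : 0 < W := by positivity
  refine ⟨min c0 (min (1/32) (W / (576 * R ^ 3))), ?_, min_le_left _ _,
    (min_le_right _ _).trans (min_le_left _ _), ?_⟩
  · have : 0 < W / (576 * (R:ℝ) ^ 3) := by positivity
    refine lt_min hc0 (lt_min (by norm_num) this)
  have hcW : min c0 (min (1/32) (W / (576 * (R:ℝ) ^ 3))) ≤ W / (576 * (R:ℝ) ^ 3) :=
    (min_le_right _ _).trans (min_le_right _ _)
  have hcpos : 0 < min c0 (min (1/32) (W / (576 * (R:ℝ) ^ 3))) := by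
    have : 0 < W / (576 * (R:ℝ) ^ 3) := by positivity
    refine lt_min hc0 (lt_min (by norm_num) this)
  generalize min c0 (min (1/32) (W / (576 * (R:ℝ) ^ 3))) = c at hcW hcpos ⊢
  rw [le_div_iff₀ (by positivity)] at hcW
  intro u hu m
  have key : ∀ i, (3 * c / (R:ℝ) ^ (m + u i)) ^ d ≤ ((1 - g) * ε * (L / R ^ m) ^ d) * g ^ i := by
    intro i
    have e1 : 3 * c / (R:ℝ) ^ (m + u i) = (3 * c / R ^ u i) * (1 / R ^ m) := by
      rw [pow_add]; field_simp
    have hV1 : 1 ≤ (R:ℝ) ^ u i := one_le_pow₀ hR1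
    have hsq : (3 * c / (R:ℝ) ^ u i) ^ 2 ≤ W * (1 / ((2:ℝ) ^ i) ^ t) := by
      have h1 := hu i
      rw [div_le_iff₀ (by positivity), pow_succ] at h1
      have hG : 0 < ((2:ℝ) ^ i) ^ t := by positivity
      generalize ((2:ℝ) ^ i) ^ t = G at h1 hG
      generalize (R:ℝ) ^ u i = V at h1 hV1
      rw [mul_one_div, div_pow, div_le_div_iff₀ (by positivity) hG]
      calc (3 * c) ^ 2 * G = 9 * c * (c * G) := by ring
        _ ≤ 9 * c * (V * R * (64 * R ^ 2)) := by gcongr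
        _ = (c * (576 * R ^ 3)) * V := by ring
        _ ≤ W * V ^ 2 := by gcongr; nlinarith
    have e2 : (3 * c / (R:ℝ) ^ u i) ^ d ≤ (ε * L ^ d * (1 - g)) * g ^ i := by
      calc (3 * c / (R:ℝ) ^ u i) ^ d = ((3 * c / (R:ℝ) ^ u i) ^ 2) ^ (d / 2) := by
            rw [← Real.rpow_natCast (3 * c / (R:ℝ) ^ u i) 2, ← Real.rpow_mul (by positivity)]
            congr 1; push_cast; ring
        _ ≤ (W * (1 / ((2:ℝ) ^ i) ^ t)) ^ (d / 2) := by gcongr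
        _ = W ^ (d / 2) * (1 / ((2:ℝ) ^ i) ^ t) ^ (d / 2) := Real.mul_rpow hW0.le (by positivity)
        _ = _ := by
          congr 1
          · rw [hW, ← Real.rpow_mul hW'.le]
            rw [show 2 / d * (d / 2) = 1 by field_simp, Real.rpow_one]
          · rw [hg, ← Real.rpow_natCast 2 i, ← Real.rpow_natCast _ i, ← Real.rpow_mul (by norm_num),
              ← Real.rpow_mul (by norm_num), one_div, ← Real.rpow_neg (by norm_num),
              ← Real.rpow_mul (by norm_num)]
            congr 1; ring
    rw [e1, Real.mul_rpow (by positivity) (by positivity)]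
    have e3 : (L / (R:ℝ) ^ m) ^ d = L ^ d * (1 / (R:ℝ) ^ m) ^ d := by
      rw [← Real.mul_rpow hL.le (by positivity)]; congr 1; ring
    rw [e3]
    have := mul_le_mul_of_nonneg_right e2 (show 0 ≤ (1 / (R:ℝ) ^ m) ^ d by positivity)
    refine this.trans_eq (by ring)
  have hs : HasSum (fun i : ℕ => ((1 - g) * ε * (L / R ^ m) ^ d) * g ^ i) (ε * (L / R ^ m) ^ d) := by
    have := (hasSum_geometric_of_lt_one hg0.le hg1).mul_left ((1 - g) * ε * (L / R ^ m) ^ d)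
    have hne : 1 - g ≠ 0 := by linarith
    have e : ((1 - g) * ε * (L / R ^ m) ^ d) * (1 - g)⁻¹ = ε * (L / R ^ m) ^ d := by
      generalize (L / (R:ℝ) ^ m) ^ d = Y
      field_simp
    rwa [e] at this
  rw [← hs.tsum_eq, ENNReal.ofReal_tsum_of_nonneg _ hs.summable]
  · exact ENNReal.tsum_le_tsum fun i => ENNReal.ofReal_le_ofReal (key i)
  · intro i
    have : 0 < 1 - g := by linarith
    positivity

lemma removable_bad {s t θ c0 a L d : ℝ} {R : ℕ} (hR : 2 ≤ R) (hs : 0 ≤ s) (ht : 0 < t)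
    (hst : s + t = 1) (hd : 0 < d) (hL : 0 < L) (hRL : R * L ≤ 1 / 8) (hc0 : 0 < c0)
    (hθ : 0 < s → ∀ q : ℕ, 0 < q → c0 ≤ (q:ℝ) ^ (1 / s) * dInt (q * θ)) :
    Removable a L R d (BadST s t θ)ᶜ := by
  classical
  intro ε hε
  have hR0 : (0:ℝ) < R := by positivity
  have hR1 : (1:ℝ) < R := by exact_mod_cast (by omega : 1 < R)
  obtain ⟨c, hc, hcc0, hc32, hsum⟩ := choose_c hR ht hd hL hε hc0
  have hu : ∀ i : ℕ, ∃ u : ℕ, (u = 0 ∨ (R:ℝ) ^ u ≤ c * ((2:ℝ) ^ i) ^ t / (64 * R ^ 2)) ∧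
      c * ((2:ℝ) ^ i) ^ t / (64 * R ^ 2) ≤ (R:ℝ) ^ (u + 1) := by
    intro i
    rcases le_total 1 (c * ((2:ℝ) ^ i) ^ t / (64 * R ^ 2)) with h | h
    · obtain ⟨u, h1, h2⟩ := exists_nat_pow_near h hR1
      exact ⟨u, Or.inr h1, h2.le⟩
    · exact ⟨0, Or.inl rfl, h.trans (one_le_pow₀ hR1.le)⟩
  choose u hu1 hu2 using hu
  have hline : ∀ (q : ℕ) (p r : ℤ), ∃ A B C : ℤ, 0 < q → |q * θ - p| * (q:ℝ) ^ s < c →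
      (B ≠ 0 ∧ |(A:ℝ)| ≤ (q:ℝ) ^ s ∧ |(B:ℝ)| ≤ (q:ℝ) ^ t ∧ A * p + B * r + C * q = 0) := by
    intro q p r
    by_cases h : 0 < q ∧ |q * θ - p| * (q:ℝ) ^ s < c
    · obtain ⟨A, B, C, hh⟩ := line_exists' hs ht.le hst hcc0 hθ h.1 p r h.2
      exact ⟨A, B, C, fun _ _ => hh⟩
    · exact ⟨0, 0, 0, fun h1 h2 => absurd ⟨h1, h2⟩ h⟩
  choose fA fB fC hf using hline
  let Q : ℕ → ℕ → ℕ → ℝ → Prop := fun m j i w => ∃ (q : ℕ) (p r : ℤ) (z : ℝ),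
    Cls s t θ c R (m + u i) i q p r (fA q p r) (fB q p r) (fC q p r) z ∧
    (a + j * (L / R ^ m) ≤ z ∧ z ≤ a + (j + 1) * (L / R ^ m)) ∧
    w = -(fA q p r * θ + fC q p r) / fB q p r
  have huniq : ∀ m j i w w', Q m j i w → Q m j i w' → w = w' := by
    rintro m j i w w' ⟨q, p, r, z, h, ⟨hz1, hz2⟩, rfl⟩ ⟨q', p', r', z', h', ⟨hz1', hz2'⟩, rfl⟩
    have hδ : |z - z'| ≤ L / R ^ m := by rw [abs_le]; constructor <;> linarith
    have hpar : fA q p r * fB q' p' r' = fA q' p' r' * fB q p r ∧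
        fB q p r * fC q' p' r' = fB q' p' r' * fC q p r := by
      have e : (R:ℝ) ^ (m + u i + 1) * (L / R ^ m) = R * L * R ^ u i := by
        rw [pow_add, pow_add]; field_simp
      rcases hu1 i with h0 | h0
      · refine Cls.uniq1 ht.le hs (by linarith) (by linarith) (by omega) hδ ?_ hc h h' ?_
        · rw [mul_assoc, e, h0, pow_zero]; linarith
        · rintro rfl rfl rfl; exact ⟨rfl, rfl, rfl⟩
      · refine Cls.uniq2 ht.le hs hst hR hδ (u := u i) ?_ hc (by linarith) ?_ h h'
        · rw [mul_assoc, e]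
          have : 0 < (R:ℝ) ^ u i := by positivity
          nlinarith
        · rw [le_div_iff₀ (by positivity)] at h0; linarith
    have hB : (fB q p r : ℝ) ≠ 0 := by exact_mod_cast h.hB0
    have hB' : (fB q' p' r' : ℝ) ≠ 0 := by exact_mod_cast h'.hB0
    have p1 : (fA q p r : ℝ) * fB q' p' r' = fA q' p' r' * fB q p r := by exact_mod_cast hpar.1
    have p2 : (fB q p r : ℝ) * fC q' p' r' = fB q' p' r' * fC q p r := by exact_mod_cast hpar.2
    rw [div_eq_div_iff hB hB']
    linear_combination -θ * p1 + p2
  refine ⟨fun m j i => if h : ∃ w, Q m j i w then h.choose else 0,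
    fun m i => 3 * c / (R:ℝ) ^ (m + u i), fun m i => by positivity, hsum u hu2, ?_⟩
  intro z j hz hav hzbad
  have hex : ∃ q, Dang s t θ c q z := by
    by_contra hcon
    push Not at hcon
    exact hzbad (bad_of_not_dang hc hcon)
  obtain ⟨hq, p, r, hp, hr⟩ := Nat.find_spec hex
  have hmin : ∀ q' < Nat.find hex, ¬ Dang s t θ c q' z := fun q' h => Nat.find_min hex h
  generalize Nat.find hex = q at hq hp hr hmin
  obtain ⟨hB0, hA, hB, hLin⟩ := hf q p r hq hp
  have hq1 : (1:ℝ) ≤ q := by exact_mod_cast hq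
  have hB1 : (1:ℝ) ≤ |(fB q p r : ℝ)| := by
    have := Int.one_le_abs hB0
    exact_mod_cast this
  obtain ⟨n, hn1, hn2⟩ := exists_nat_pow_near (show (1:ℝ) ≤ q * |(fB q p r : ℝ)| by nlinarith) hR1
  have hRn : (0:ℝ) < (R:ℝ) ^ n := by positivity
  have hx : 1 ≤ (q:ℝ) * (q:ℝ) ^ t / R ^ n := by
    rw [one_le_div hRn]
    refine hn1.trans (by gcongr)
  obtain ⟨i, hi1, hi2⟩ := exists_nat_pow_near hx (show (1:ℝ) < 2 by norm_num)
  rw [le_div_iff₀ hRn] at hi1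
  rw [div_lt_iff₀ hRn] at hi2
  have hun : u i ≤ n := by
    rcases hu1 i with h0 | h0
    · omega
    · have hqt : (q:ℝ) ^ t ≤ q := by
        calc (q:ℝ) ^ t ≤ (q:ℝ) ^ (1:ℝ) := Real.rpow_le_rpow_of_exponent_le hq1 (by linarith)
          _ = q := Real.rpow_one _
      have hqR : (q:ℝ) ≤ R ^ (n+1) := by nlinarith
      have h2i : ((2:ℝ) ^ i) ^ t ≤ 2 ^ i := by
        calc ((2:ℝ) ^ i) ^ t ≤ ((2:ℝ) ^ i) ^ (1:ℝ) :=
              Real.rpow_le_rpow_of_exponent_le (one_le_pow₀ (by norm_num)) (by linarith)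
          _ = _ := Real.rpow_one _
      have h3 : (2:ℝ) ^ i ≤ R ^ (n + 2) := by
        have : (2:ℝ) ^ i * R ^ n ≤ R ^ (n+2) * R ^ n := by
          calc (2:ℝ) ^ i * R ^ n ≤ q * (q:ℝ) ^ t := hi1
            _ ≤ R ^ (n+1) * R ^ (n+1) := by gcongr; exact hqt.trans hqR
            _ = _ := by ring
        exact le_of_mul_le_mul_right this hRn
      have h4 : (R:ℝ) ^ u i ≤ R ^ n := by
        refine h0.trans ?_
        rw [div_le_iff₀ (by positivity)]
        calc c * ((2:ℝ) ^ i) ^ t ≤ 1 * R ^ (n+2) := by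
              gcongr
              · linarith
              · exact h2i.trans h3
          _ = R ^ n * R ^ 2 := by ring
          _ ≤ R ^ n * (64 * R ^ 2) := by gcongr; nlinarith [sq_nonneg (R:ℝ)]
      exact (pow_le_pow_iff_right₀ hR1).1 h4
  obtain ⟨m, rfl⟩ : ∃ m, n = m + u i := ⟨n - u i, by omega⟩
  have hcls : Cls s t θ c R (m + u i) i q p r (fA q p r) (fB q p r) (fC q p r) z :=
    ⟨hq, hp, hr, hmin, hA, hB, hB0, hLin, hn1, hn2, hi1, hi2⟩
  have hQ : Q m (j m) i (-(fA q p r * θ + fC q p r) / fB q p r) := ⟨q, p, r, z, hcls, hz m, rfl⟩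
  have hexw : ∃ w, Q m (j m) i w := ⟨_, hQ⟩
  have h1 := hav m i
  simp only [dif_pos hexw] at h1
  rw [huniq _ _ _ _ _ hexw.choose_spec hQ] at h1
  have h2 := hcls.near (by omega)
  have h3 := h1.trans h2
  rw [div_le_div_iff_of_pos_right hRn] at h3
  linarith

lemma removable_null {a L d : ℝ} {R : ℕ} (hR : 2 ≤ R) (hd : 0 < d) (hL : 0 < L) {S : Set ℝ}
    (hS : MeasureTheory.Measure.hausdorffMeasure d S = 0) : Removable a L R d S := by
  classical
  intro ε hε
  have hR0 : (0:ℝ) < R := by positivity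
  set E : ℝ := ε * L ^ d / 2 with hE
  have hE0 : 0 < E := by positivity
  rw [MeasureTheory.Measure.hausdorffMeasure_apply] at hS
  have h1 : (⨅ (t : ℕ → Set ℝ) (_ : S ⊆ ⋃ n, t n) (_ : ∀ n, Metric.ediam (t n) ≤ 1),
      ∑' n, ⨆ _ : (t n).Nonempty, Metric.ediam (t n) ^ d) < ENNReal.ofReal E := by
    refine lt_of_le_of_lt ?_ (ENNReal.ofReal_pos.2 hE0)
    rw [← hS]
    exact le_iSup₂_of_le (1:ℝ≥0∞) one_pos le_rfl
  simp only [iInf_lt_iff] at h1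
  obtain ⟨T, hcov, hdiam, hsum⟩ := h1
  set τ : ℕ → ℝ := fun n => E * (1 / 2) ^ (n + 1) with hτ
  have hτ0 : ∀ n, 0 < τ n := fun n => by positivity
  have hτs : HasSum τ E := hasSum_half E
  set D : ℕ → ℝ := fun n => (Metric.ediam (T n)).toReal with hD
  have hDfin : ∀ n, Metric.ediam (T n) ≠ ⊤ := fun n => ne_top_of_le_ne_top ENNReal.one_ne_top (hdiam n)
  have hD0 : ∀ n, 0 ≤ D n := fun n => ENNReal.toReal_nonneg
  set σ : ℕ → ℝ := fun n => (D n ^ d + τ n) ^ (1 / d) with hσ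
  have hσpos : ∀ n, 0 < σ n := fun n => by have := hτ0 n; have := hD0 n; positivity
  have hσD : ∀ n, D n < σ n := by
    intro n
    calc D n = (D n ^ d) ^ (1 / d) := by
          rw [← Real.rpow_mul (hD0 n), mul_one_div_cancel hd.ne', Real.rpow_one]
      _ < σ n := Real.rpow_lt_rpow (Real.rpow_nonneg (hD0 n) _) (by linarith [hτ0 n]) (by positivity)
  have hσd : ∀ n, σ n ^ d = D n ^ d + τ n := by
    intro n
    have := hτ0 n
    have := hD0 n
    simp only [hσ]
    rw [← Real.rpow_mul (by positivity), one_div_mul_cancel hd.ne', Real.rpow_one]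
  have hσsum : ∑' n, ENNReal.ofReal (σ n ^ d) ≤ ENNReal.ofReal (ε * L ^ d) := by
    have e : ε * L ^ d = E + E := by rw [hE]; ring
    rw [e, ENNReal.ofReal_add hE0.le hE0.le]
    simp_rw [hσd]
    have : ∀ n, ENNReal.ofReal (D n ^ d + τ n) = ENNReal.ofReal (D n ^ d) + ENNReal.ofReal (τ n) :=
      fun n => ENNReal.ofReal_add (Real.rpow_nonneg (hD0 n) _) (hτ0 n).le
    simp_rw [this]
    rw [ENNReal.tsum_add]
    refine add_le_add (le_trans (ENNReal.tsum_le_tsum fun n => ?_) hsum.le) ?_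
    · rw [← ENNReal.ofReal_rpow_of_nonneg (hD0 n) hd.le, ENNReal.ofReal_toReal (hDfin n)]
      rcases (T n).eq_empty_or_nonempty with h | h
      · simp [h, hd]
      · exact le_iSup_of_le h le_rfl
    · rw [← ENNReal.ofReal_tsum_of_nonneg (fun n => (hτ0 n).le) hτs.summable, hτs.tsum_eq]
  refine ⟨fun _ _ i => if h : (T i).Nonempty then h.some else 0, fun m i => σ i * (1 / R ^ m),
    fun m i => by have := hσpos i; positivity, fun m => ?_, ?_⟩
  · have e3 : (L / (R:ℝ) ^ m) ^ d = L ^ d * (1 / (R:ℝ) ^ m) ^ d := by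
      rw [← Real.mul_rpow hL.le (by positivity)]; congr 1; ring
    rw [e3, ← mul_assoc, ENNReal.ofReal_mul (by positivity)]
    have : ∀ i, ENNReal.ofReal ((σ i * (1 / (R:ℝ) ^ m)) ^ d) =
        ENNReal.ofReal (σ i ^ d) * ENNReal.ofReal ((1 / (R:ℝ) ^ m) ^ d) := by
      intro i
      rw [Real.mul_rpow (hσpos i).le (by positivity), ENNReal.ofReal_mul (Real.rpow_nonneg (hσpos i).le _)]
    simp_rw [this]
    rw [ENNReal.tsum_mul_right]
    gcongr
  · intro z j _ hav hz
    obtain ⟨n, hn⟩ := Set.mem_iUnion.1 (hcov hz)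
    have hne : (T n).Nonempty := ⟨z, hn⟩
    have h1 := hav 0 n
    simp only [dif_pos hne, pow_zero, div_one, mul_one] at h1
    have h2 : dist z hne.some ≤ D n := by
      rw [dist_edist]
      exact ENNReal.toReal_mono (hDfin n) (Metric.edist_le_ediam_of_mem hn hne.some_mem)
    rw [Real.dist_eq] at h2
    linarith [hσD n]

lemma exists_avoid {a L d : ℝ} {R : ℕ} (hR : 2 ≤ R) (hd : 0 < d) (hL : 0 < L)
    (hRd : 4 * (R:ℝ) ^ d ≤ R) (S : ℕ → Set ℝ) (hS : ∀ k, Removable a L R d (S k)) :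
    ∃ z, a ≤ z ∧ z ≤ a + L ∧ ∀ k, z ∉ S k := by
  have hR0 : (0:ℝ) < R := by positivity
  set E : ℝ := 1 / 2 * (1 / (4 * R)) ^ d with hE
  have hE0 : 0 < E := by positivity
  have hεs : HasSum (fun n : ℕ => E * (1 / 2) ^ (n + 1)) E := hasSum_half E
  choose y ρ hρ hsum hav using fun k => hS k (E * (1 / 2) ^ (k + 1)) (by positivity)
  obtain ⟨z, j, hj0, hz, hzav⟩ := noncover (ι := ℕ × ℕ) a L hL R hR d hd hRd
    (fun m j x => y x.1 m j x.2) (fun m x => ρ x.1 m x.2) (fun m x => hρ _ _ _) (by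
      intro m
      rw [ENNReal.tsum_prod (f := fun k i => ENNReal.ofReal (ρ k m i ^ d))]
      refine (ENNReal.tsum_le_tsum fun k => hsum k m).trans ?_
      rw [← ENNReal.ofReal_tsum_of_nonneg (fun k => by positivity) (hεs.summable.mul_right _),
        (hεs.mul_right _).tsum_eq]
      apply ENNReal.ofReal_le_ofReal
      rw [hE, mul_assoc])
  refine ⟨z, ?_, ?_, fun k => hav k z j hz fun m i => hzav m (k, i)⟩
  · have := (hz 0).1; simpa [hj0] using this
  · have := (hz 0).2; simpa [hj0] using this

theorem bpv_thick_no_tech (sn tn : ℕ → ℝ) (hs : ∀ n, 0 ≤ sn n) (ht : ∀ n, 0 ≤ tn n)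
    (hst : ∀ n, sn n + tn n = 1)
    (θ : ℝ)
    (hθ : (⨆ n, sn n) ≠ 0 →
      0 < ⨅ q : {q : ℕ // 0 < q}, (q : ℝ) ^ (1 / ⨆ n, sn n) * dInt ((q : ℝ) * θ)) :
    ∀ a b : ℝ, a < b →
      dimH (Set.Ioo a b ∩ ⋂ n : ℕ, BadST (sn n) (tn n) θ) = 1 := by
  intro a b hab
  set S := Set.Ioo a b ∩ ⋂ n : ℕ, BadST (sn n) (tn n) θ with hSdef
  refine le_antisymm ((dimH_mono (Set.subset_univ S)).trans_eq Real.dimH_univ) ?_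
  by_contra hcon
  push Not at hcon
  obtain ⟨d, hd1, hd2⟩ := ENNReal.lt_iff_exists_nnreal_btwn.1 hcon
  have hd2' : (d:ℝ) < 1 := by exact_mod_cast hd2
  have hd0 : (0:ℝ) < d := by
    have : (0:ℝ≥0∞) < d := lt_of_le_of_lt zero_le hd1
    exact_mod_cast this
  have hnull := hausdorffMeasure_of_dimH_lt hd1
  -- choose R
  obtain ⟨R, hR, hRd⟩ : ∃ R : ℕ, 2 ≤ R ∧ 4 * (R:ℝ) ^ (d:ℝ) ≤ R := by
    have h1 : Filter.Tendsto (fun n : ℕ => (n:ℝ) ^ (1 - (d:ℝ))) Filter.atTop Filter.atTop :=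
      (tendsto_rpow_atTop (by linarith)).comp tendsto_natCast_atTop_atTop
    obtain ⟨R, h2, h3⟩ := ((h1.eventually_ge_atTop 4).and (Filter.eventually_ge_atTop 2)).exists
    refine ⟨R, h3, ?_⟩
    have hR0 : (0:ℝ) < R := by positivity
    calc 4 * (R:ℝ) ^ (d:ℝ) ≤ (R:ℝ) ^ (1 - (d:ℝ)) * (R:ℝ) ^ (d:ℝ) := by gcongr
      _ = R := by rw [← Real.rpow_add hR0]; simp
  have hR0 : (0:ℝ) < R := by positivity
  set L : ℝ := min ((b - a) / 4) (1 / (8 * R)) with hL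
  have hL0 : 0 < L := lt_min (by linarith) (by positivity)
  have hRL : R * L ≤ 1 / 8 := by
    calc R * L ≤ R * (1 / (8 * R)) := by gcongr; exact min_le_right _ _
      _ = 1 / 8 := by field_simp
  have hLab : L ≤ (b - a) / 4 := min_le_left _ _
  have hrem : ∀ n, Removable (a + (b - a) / 4) L R d (BadST (sn n) (tn n) θ)ᶜ := by
    intro n
    have hbdd : BddAbove (Set.range sn) := ⟨1, by
      rintro _ ⟨k, rfl⟩; linarith [hst k, ht k]⟩
    -- lower bound
    have hlow : ∃ c0 : ℝ, 0 < c0 ∧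
        (0 < sn n → ∀ q : ℕ, 0 < q → c0 ≤ (q:ℝ) ^ (1 / sn n) * dInt (q * θ)) := by
      rcases (hs n).eq_or_lt with h0 | h0
      · exact ⟨1, one_pos, fun h => by linarith⟩
      · have hle : sn n ≤ ⨆ n, sn n := le_ciSup hbdd n
        have hpos : 0 < ⨆ n, sn n := h0.trans_le hle
        refine ⟨_, hθ hpos.ne', fun _ q hq => ?_⟩
        have hq1 : (1:ℝ) ≤ q := by exact_mod_cast hq
        refine (ciInf_le ⟨0, ?_⟩ (⟨q, hq⟩ : {q : ℕ // 0 < q})).trans ?_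
        · rintro _ ⟨k, rfl⟩
          exact mul_nonneg (by positivity) (dInt_nonneg _)
        · refine mul_le_mul_of_nonneg_right ?_ (dInt_nonneg _)
          exact Real.rpow_le_rpow_of_exponent_le hq1 (one_div_le_one_div_of_le h0 hle)
    obtain ⟨c0, hc0, hlow⟩ := hlow
    rcases (ht n).eq_or_lt with h0 | h0
    · have hs1 : sn n = 1 := by linarith [hst n]
      have : (BadST (sn n) (tn n) θ)ᶜ = ∅ := by
        rw [Set.compl_empty_iff, Set.eq_univ_iff_forall]
        intro z
        have : Nonempty {q : ℕ // 0 < q} := ⟨⟨1, one_pos⟩⟩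
        refine lt_of_lt_of_le hc0 (le_ciInf fun q => le_max_of_le_left ?_)
        have := hlow (by rw [hs1]; exact one_pos) q q.2
        rw [hs1, div_one] at this
        rw [hs1]; exact this
      rw [this]
      exact removable_null hR hd0 hL0 (by simp)
    · exact removable_bad hR (hs n) h0 (hst n) hd0 hL0 hRL hc0 hlow
  obtain ⟨z, hz1, hz2, hz⟩ := exists_avoid (a := a + (b - a) / 4) hR hd0 hL0 hRd
    (fun k => Nat.casesOn k S fun n => (BadST (sn n) (tn n) θ)ᶜ) (by
      intro k
      cases k with
      | zero => exact removable_null hR hd0 hL0 hnull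
      | succ n => exact hrem n)
  refine hz 0 ?_
  refine ⟨⟨by linarith, by linarith⟩, Set.mem_iInter.2 fun n => ?_⟩
  have := hz (n+1)
  simpa using this
end

section
/- Let (s_n, t_n)_{n=1}^∞ be a sequence of pairs of nonnegative real numbers with s_n + t_n = 1 for all n. Then the set ⋂_{n=1}^∞ Bad(s_n, t_n) is thick in ℝ², i.e. for every nonempty open ball B ⊆ ℝ², the Hausdorff dimension of B ∩ ⋂_{n=1}^∞ Bad(s_n, t_n) equals 2. -/
/-- `Bad(s,t)`: the set of `(s,t)`-badly approximable pairs in `ℝ²`. -/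
noncomputable def Bad2 (s t : ℝ) : Set (ℝ × ℝ) :=
  {p : ℝ × ℝ | 0 < ⨅ q : {q : ℕ // 0 < q},
      max ((q : ℝ) ^ s * dInt ((q : ℝ) * p.1)) ((q : ℝ) ^ t * dInt ((q : ℝ) * p.2))}

open Set

theorem tsum_level {ι : Type*} (w : ℕ → ι → ℕ → ENNReal) (m : ℕ) :
    ∑' p : ℕ × ι, (if p.1 = m then w p.1 p.2 m else 0) = ∑' i, w m i m := by
  rw [ENNReal.tsum_prod (f := fun a b => if a = m then w a b m else 0), tsum_eq_single m]
  · simp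
  · intro b hb; simp [hb]

open Classical in
theorem potential_game {X κ ι : Type*} [MetricSpace X] [ProperSpace X] [Fintype κ] [Nonempty κ]
    (ρ : ℕ → ℝ) (hρ : ∀ m, 0 ≤ ρ m) (ch : ℕ → X → κ → X)
    (hch : ∀ m z c, Metric.closedBall (ch m z c) (ρ (m+1)) ⊆ Metric.closedBall z (ρ m))
    (O : ℕ → X → ι → Set X) (w : ℕ → ι → ℕ → ENNReal)
    (h1 : ∀ m z i m' z', w m i m' < 1 →
      ∑ c : κ, (if (O m z i ∩ Metric.closedBall (ch m' z' c) (ρ (m'+1))).Nonempty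
        then w m i (m'+1) else 0) ≤ (Fintype.card κ : ENNReal) * (2⁻¹ * w m i m'))
    (h2 : ∀ m z i, (O m z i).Nonempty → ∃ m', m ≤ m' ∧ 1 ≤ w m i m')
    (h3 : ∀ m, ∑' i, w m i m ≤ 4⁻¹) (z0 : X) :
    ∃ (zs : ℕ → X) (z : X), zs 0 = z0 ∧ (∀ m, z ∈ Metric.closedBall (zs m) (ρ m)) ∧
      ∀ m i, z ∉ O m (zs m) i := by
  set S : ℕ → X → Set X := fun m z => Metric.closedBall z (ρ m) with hS
  -- potential
  let Φ : (ℕ → X) → ℕ → ℕ → X → ENNReal := fun h m m' z =>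
    ∑' p : ℕ × ι, if p.1 ≤ m ∧ (O p.1 (h p.1) p.2 ∩ S m' z).Nonempty then w p.1 p.2 m' else 0
  have step : ∀ m (h : ℕ → X), Φ h m m (h m) ≤ 2⁻¹ →
      ∃ c, Φ (Function.update h (m+1) (ch m (h m) c)) (m+1) (m+1) (ch m (h m) c) ≤ 2⁻¹ := by
    intro m h hΦ
    have hsum : ∑ c : κ, Φ h m (m+1) (ch m (h m) c) ≤ ∑ c : κ, 2⁻¹ * Φ h m m (h m) := by
      rw [Finset.sum_const, Finset.card_univ, nsmul_eq_mul]
      simp only [Φ]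
      rw [← Summable.tsum_finsetSum (fun _ _ => ENNReal.summable), ← ENNReal.tsum_mul_left,
        ← ENNReal.tsum_mul_left]
      refine ENNReal.tsum_le_tsum fun p => ?_
      by_cases hp : p.1 ≤ m
      · by_cases hm : (O p.1 (h p.1) p.2 ∩ S m (h m)).Nonempty
        · have hw : w p.1 p.2 m < 1 := by
            refine lt_of_le_of_lt ?_ (lt_of_le_of_lt hΦ (by simp))
            refine le_trans ?_ (ENNReal.le_tsum p)
            rw [if_pos ⟨hp, hm⟩]
          rw [if_pos ⟨hp, hm⟩]
          simpa [hp] using h1 p.1 (h p.1) p.2 m (h m) hw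
        · have : ∀ c, ¬ (O p.1 (h p.1) p.2 ∩ S (m+1) (ch m (h m) c)).Nonempty := by
            rintro c ⟨y, hy1, hy2⟩
            exact hm ⟨y, hy1, hch _ _ _ hy2⟩
          simp [this]
      · simp [hp]
    obtain ⟨c, hc⟩ : ∃ c, Φ h m (m+1) (ch m (h m) c) ≤ 2⁻¹ * Φ h m m (h m) := by
      obtain ⟨c, -, hmin⟩ := Finset.exists_min_image Finset.univ
        (fun c => Φ h m (m+1) (ch m (h m) c)) Finset.univ_nonempty
      refine ⟨c, ?_⟩
      have h5 : ∑ _c : κ, Φ h m (m+1) (ch m (h m) c) ≤ ∑ c : κ, Φ h m (m+1) (ch m (h m) c) :=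
        Finset.sum_le_sum fun c' hc' => hmin c' hc'
      have h6 := h5.trans hsum
      rw [Finset.sum_const, Finset.sum_const, nsmul_eq_mul, nsmul_eq_mul, Finset.card_univ] at h6
      exact (ENNReal.mul_le_mul_iff_right (by simp) (by simp)).1 h6
    refine ⟨c, ?_⟩
    set z' := ch m (h m) c
    have : Φ (Function.update h (m+1) z') (m+1) (m+1) z' ≤
        Φ h m (m+1) z' + ∑' p : ℕ × ι, if p.1 = m+1 then w p.1 p.2 (m+1) else 0 := by
      simp only [Φ]
      rw [← ENNReal.tsum_add]
      refine ENNReal.tsum_le_tsum fun p => ?_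
      by_cases hp : p.1 = m + 1
      · rw [if_pos hp]
        refine le_trans ?_ le_add_self
        split_ifs <;> simp
      · rw [if_neg hp, add_zero, Function.update_of_ne hp]
        by_cases hp2 : p.1 ≤ m
        · have : p.1 ≤ m + 1 := by omega
          simp [hp2, this]
        · have : ¬ p.1 ≤ m + 1 := by omega
          simp [this]
    refine this.trans ?_
    have h4 : ∑' p : ℕ × ι, (if p.1 = m+1 then w p.1 p.2 (m+1) else 0) ≤ 4⁻¹ := by
      rw [tsum_level w (m+1)]
      exact h3 (m+1)
    calc _ ≤ (2⁻¹ * 2⁻¹ : ENNReal) + 4⁻¹ := by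
            gcongr
            exact hc.trans (by gcongr)
      _ = 2⁻¹ := by
          rw [← ENNReal.toReal_eq_toReal_iff' (by finiteness) (by finiteness)]
          rw [ENNReal.toReal_add (by finiteness) (by finiteness)]
          simp; norm_num
  choose! cc hcc using step
  let next : ℕ → (ℕ → X) → (ℕ → X) := fun m h => Function.update h (m+1) (ch m (h m) (cc m h))
  let H : ℕ → (ℕ → X) := fun m => Nat.rec (fun _ => z0) next m
  have Hs : ∀ m, H (m+1) = next m (H m) := fun m => rfl
  have Hst : ∀ m j, j ≤ m → H m j = H j j := by
    intro m
    induction m with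
    | zero => intro j hj; obtain rfl : j = 0 := by omega
              rfl
    | succ m ih =>
      intro j hj
      rcases Nat.lt_or_ge j (m+1) with h | h
      · rw [Hs]
        simp only [next]
        rw [Function.update_of_ne (by omega)]
        exact ih j (by omega)
      · obtain rfl : j = m + 1 := by omega
        rfl
  have HΦ : ∀ m, Φ (H m) m m (H m m) ≤ 2⁻¹ := by
    intro m
    induction m with
    | zero =>
      refine le_trans ?_ ((h3 0).trans (by simp; norm_num))
      have h4 : ∑' p : ℕ × ι, (if p.1 = 0 then w p.1 p.2 0 else 0) = ∑' i, w 0 i 0 := tsum_level w 0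
      rw [← h4]
      refine ENNReal.tsum_le_tsum fun p => ?_
      by_cases hp : p.1 = 0
      · rw [if_pos hp]
        split_ifs <;> simp
      · simp [hp]
    | succ m ih =>
      have := hcc m (H m) ih
      have e : H (m+1) (m+1) = ch m (H m m) (cc m (H m)) := by
        rw [Hs]; simp [next]
      rw [e]
      exact this
  let zs : ℕ → X := fun m => H m m
  have hnest : ∀ m, S (m+1) (zs (m+1)) ⊆ S m (zs m) := by
    intro m
    have e : H (m+1) (m+1) = ch m (H m m) (cc m (H m)) := by
      rw [Hs]; simp [next]
    simp only [zs, e]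
    exact hch _ _ _
  obtain ⟨z, hz⟩ := IsCompact.nonempty_iInter_of_sequence_nonempty_isCompact_isClosed
    (fun m => S m (zs m)) hnest (fun m => ⟨zs m, by simp [hS, hρ]⟩)
    (isCompact_closedBall _ _) (fun m => Metric.isClosed_closedBall)
  simp only [mem_iInter] at hz
  refine ⟨zs, z, rfl, hz, ?_⟩
  intro m i hmem
  obtain ⟨m', hm', hw⟩ := h2 m (zs m) i ⟨z, hmem⟩
  have : w m i m' ≤ 2⁻¹ := by
    refine le_trans ?_ (HΦ m')
    refine le_trans ?_ (ENNReal.le_tsum (m, i))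
    rw [if_pos]
    refine ⟨hm', z, ?_, hz m'⟩
    simp only
    rw [Hst m' m hm']
    exact hmem
  have := hw.trans this
  norm_num at this

/-- counting -/
theorem count_le (R : ℕ) (h a : ℝ) (hh : 0 < h) (P : Fin R → Prop) [DecidablePred P]
    (hP : ∀ i, P i → |a + h * (i : ℕ)| ≤ (3/2) * h) :
    (Finset.univ.filter P).card ≤ 4 := by
  set lo : ℤ := ⌈-a/h - 3/2⌉
  have key : ∀ i, P i → ((i : ℕ) : ℤ) ∈ Finset.Icc lo (lo + 3) := by
    intro i hi
    have := abs_le.1 (hP i hi)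
    have h1 : -a/h - 3/2 ≤ (i:ℕ) := by
      have : -a/h - 3/2 = (-a - 3/2*h)/h := by field_simp
      rw [this, div_le_iff₀ hh]; nlinarith
    have h2 : ((i:ℕ):ℝ) ≤ -a/h + 3/2 := by
      have : -a/h + 3/2 = (-a + 3/2*h)/h := by field_simp
      rw [this, le_div_iff₀ hh]; nlinarith
    rw [Finset.mem_Icc]
    constructor
    · exact Int.ceil_le.2 (by exact_mod_cast h1)
    · have h3 : (-a/h - 3/2 : ℝ) ≤ lo := Int.le_ceil _
      have : (((i:ℕ):ℤ) : ℝ) ≤ ((lo + 3 : ℤ) : ℝ) := by push_cast; linarith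
      exact_mod_cast this
  have : ((Finset.univ.filter P).image (fun i : Fin R => ((i:ℕ):ℤ))).card = (Finset.univ.filter P).card := by
    apply Finset.card_image_of_injective
    intro i j hij
    exact Fin.ext (by simpa using hij)
  rw [← this]
  refine (Finset.card_le_card (t := Finset.Icc lo (lo+3)) ?_).trans (by simp; omega)
  intro y hy
  simp only [Finset.mem_image, Finset.mem_filter, Finset.mem_univ, true_and] at hy
  obtain ⟨i, hi, rfl⟩ := hy
  exact key i hi

theorem count_prod_snd {R : ℕ} (P : Fin R × Fin R → Prop) [DecidablePred P]
    (h : ∀ j, (Finset.univ.filter (fun i => P (i, j))).card ≤ 4) :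
    (Finset.univ.filter P).card ≤ 4 * R := by
  have := Finset.card_eq_sum_card_fiberwise (s := Finset.univ.filter P) (t := (Finset.univ : Finset (Fin R)))
    (f := Prod.snd) (by intro x _; simp)
  rw [this]
  calc _ ≤ ∑ _b : Fin R, 4 := by
        apply Finset.sum_le_sum
        intro b _
        refine le_trans ?_ (h b)
        apply Finset.card_le_card_of_injOn Prod.fst
        · intro x hx
          simp at hx ⊢
          rw [← hx.2]; exact hx.1
        · intro x hx y hy hxy
          simp at hx hy
          exact Prod.ext hxy (hx.2.trans hy.2.symm)
    _ = 4 * R := by simp [mul_comm]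

theorem count_prod_fst {R : ℕ} (P : Fin R × Fin R → Prop) [DecidablePred P]
    (h : ∀ i, (Finset.univ.filter (fun j => P (i, j))).card ≤ 4) :
    (Finset.univ.filter P).card ≤ 4 * R := by
  have := Finset.card_eq_sum_card_fiberwise (s := Finset.univ.filter P) (t := (Finset.univ : Finset (Fin R)))
    (f := Prod.fst) (by intro x _; simp)
  rw [this]
  calc _ ≤ ∑ _b : Fin R, 4 := by
        apply Finset.sum_le_sum
        intro b _
        refine le_trans ?_ (h b)
        apply Finset.card_le_card_of_injOn Prod.snd
        · intro x hx
          simp at hx ⊢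
          rw [← hx.2]; exact hx.1
        · intro x hx y hy hxy
          simp at hx hy
          exact Prod.ext (hx.2.trans hy.2.symm) hxy
    _ = 4 * R := by simp [mul_comm]

/-- children of a square -/
noncomputable def chd (R : ℕ) (ρ : ℝ) (z : ℝ × ℝ) (c : Fin R × Fin R) : ℝ × ℝ :=
  (z.1 + (2 * (c.1 : ℕ) + 1 - R) * (ρ / R), z.2 + (2 * (c.2 : ℕ) + 1 - R) * (ρ / R))

theorem mem_cb {z y : ℝ × ℝ} {ρ : ℝ} :
    y ∈ Metric.closedBall z ρ ↔ |y.1 - z.1| ≤ ρ ∧ |y.2 - z.2| ≤ ρ := by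
  rw [Metric.mem_closedBall, Prod.dist_eq, max_le_iff, Real.dist_eq, Real.dist_eq]

theorem chd_aux (R : ℕ) (ρ a y : ℝ) (hρ : 0 < ρ) (i : Fin R)
    (h : |y - (a + (2 * (i : ℕ) + 1 - R) * (ρ / R))| ≤ ρ / R) : |y - a| ≤ ρ := by
  have hi : ((i:ℕ):ℝ) + 1 ≤ R := by exact_mod_cast i.2
  have h0 : (0:ℝ) ≤ (i:ℕ) := by positivity
  have hR : (0:ℝ) < R := by linarith
  set e := ρ / R
  have he : 0 < e := by positivity
  have hr : ρ = R * e := by simp only [e]; field_simp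
  rw [abs_le] at h ⊢
  rw [hr]
  constructor <;> nlinarith

theorem chd_sub (R : ℕ) (ρ : ℝ) (z : ℝ × ℝ) (c : Fin R × Fin R) (hρ : 0 < ρ) :
    Metric.closedBall (chd R ρ z c) (ρ / R) ⊆ Metric.closedBall z ρ := by
  intro y hy
  rw [mem_cb] at hy ⊢
  exact ⟨chd_aux R ρ z.1 y.1 hρ c.1 hy.1, chd_aux R ρ z.2 y.2 hρ c.2 hy.2⟩

def strip (A B C δ : ℝ) : Set (ℝ × ℝ) := {u | |A * u.1 + B * u.2 + C| ≤ δ * max |A| |B|}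

theorem strip_aux {A B C δ e x y x0 y0 : ℝ} (hδ : δ ≤ e) (hA : A ≠ 0) (hBA : |B| ≤ |A|)
    (h : |A * x + B * y + C| ≤ δ * |A|) (hx : |x - x0| ≤ e) (hy : |y - y0| ≤ e) :
    |x0 + (B * y0 + C) / A| ≤ 3 * e := by
  have hA' : 0 < |A| := abs_pos.2 hA
  have : x0 + (B * y0 + C) / A = (A * x0 + B * y0 + C) / A := by field_simp; ring
  rw [this, abs_div, div_le_iff₀ hA']
  have : A * x0 + B * y0 + C = (A * x + B * y + C) - A * (x - x0) - B * (y - y0) := by ring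
  rw [this]
  have h1 : |A * (x - x0)| ≤ |A| * e := by rw [abs_mul]; gcongr
  have h2 : |B * (y - y0)| ≤ |A| * e := by rw [abs_mul]; gcongr
  have h3 : δ * |A| ≤ e * |A| := by gcongr
  calc _ ≤ |A * x + B * y + C| + |A * (x - x0)| + |B * (y - y0)| := by
        refine (abs_sub _ _).trans ?_
        gcongr
        exact abs_sub _ _
    _ ≤ _ := by linarith

open Classical in
theorem strip_count (R : ℕ) (hR : 0 < R) (ρ : ℝ) (hρ : 0 < ρ) (A B C δ : ℝ) (hAB : 0 < max |A| |B|)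
    (hδ : δ ≤ ρ / R) (z : ℝ × ℝ) :
    (Finset.univ.filter (fun c : Fin R × Fin R =>
      (strip A B C δ ∩ Metric.closedBall (chd R ρ z c) (ρ / R)).Nonempty)).card ≤ 4 * R := by
  have hR' : (0:ℝ) < R := by exact_mod_cast hR
  have he : 0 < ρ / R := by positivity
  rcases le_total |B| |A| with h | h
  · rw [max_eq_left h] at hAB
    apply count_prod_snd
    intro j
    apply count_le R (2 * (ρ / R)) (z.1 + (1 - R) * (ρ / R) + (B * (z.2 + (2 * (j : ℕ) + 1 - R) * (ρ / R)) + C) / A) (by positivity)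
    rintro i ⟨u, hu, hu2⟩
    rw [mem_cb] at hu2
    simp only [strip, mem_ofPred_eq, max_eq_left h] at hu
    have := strip_aux hδ (abs_pos.1 hAB) h hu hu2.1 hu2.2
    simp only [chd] at this
    calc _ = _ := by congr 1; ring
      _ ≤ _ := this
      _ = _ := by ring
  · rw [max_eq_right h] at hAB
    apply count_prod_fst
    intro j
    apply count_le R (2 * (ρ / R)) (z.2 + (1 - R) * (ρ / R) + (A * (z.1 + (2 * (j : ℕ) + 1 - R) * (ρ / R)) + C) / B) (by positivity)
    rintro i ⟨u, hu, hu2⟩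
    rw [mem_cb] at hu2
    simp only [strip, mem_ofPred_eq, max_eq_right h] at hu
    rw [add_comm (A * u.1)] at hu
    have := strip_aux hδ (abs_pos.1 hAB) h hu hu2.2 hu2.1
    simp only [chd] at this
    calc _ = _ := by congr 1; ring
      _ ≤ _ := this
      _ = _ := by ring

open Classical in
theorem ball_count (R : ℕ) (hR : 0 < R) (ρ : ℝ) (hρ : 0 < ρ) (U : Set (ℝ × ℝ)) (δ : ℝ)
    (hU : ∀ x ∈ U, ∀ y ∈ U, dist x y ≤ δ)
    (hδ : δ ≤ ρ / R) (z : ℝ × ℝ) :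
    (Finset.univ.filter (fun c : Fin R × Fin R =>
      (U ∩ Metric.closedBall (chd R ρ z c) (ρ / R)).Nonempty)).card ≤ 16 := by
  have hR' : (0:ℝ) < R := by exact_mod_cast hR
  have he : 0 < ρ / R := by positivity
  rcases U.eq_empty_or_nonempty with rfl | ⟨p, hp⟩
  · simp
  have key : ∀ (a : ℝ) (b : ℝ), (Finset.univ.filter (fun i : Fin R => |a + (2 * (i : ℕ) + 1 - R) * (ρ / R) - b| ≤ 2 * (ρ/R))).card ≤ 4 := by
    intro a b
    apply count_le R (2 * (ρ / R)) (a + (1 - R) * (ρ / R) - b) (by positivity)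
    intro i hi
    calc _ = _ := by congr 1; ring
      _ ≤ _ := hi
      _ ≤ _ := by linarith
  calc _ ≤ ((Finset.univ.filter (fun i : Fin R => |z.1 + (2 * (i : ℕ) + 1 - R) * (ρ / R) - p.1| ≤ 2 * (ρ/R))) ×ˢ
      (Finset.univ.filter (fun i : Fin R => |z.2 + (2 * (i : ℕ) + 1 - R) * (ρ / R) - p.2| ≤ 2 * (ρ/R)))).card := by
        apply Finset.card_le_card
        intro c hc
        simp only [Finset.mem_filter, Finset.mem_univ, true_and, Finset.mem_product] at hc ⊢
        obtain ⟨u, hu, hu2⟩ := hc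
        have h1 := hU u hu p hp
        rw [← Metric.mem_closedBall, mem_cb] at h1
        rw [mem_cb] at hu2
        simp only [chd, abs_le] at hu2 h1
        simp only [abs_le]
        refine ⟨⟨?_, ?_⟩, ?_, ?_⟩ <;> linarith [hu2.1.1, hu2.1.2, hu2.2.1, hu2.2.2, h1.1.1, h1.1.2, h1.2.1, h1.2.2]
    _ ≤ 4 * 4 := by
        rw [Finset.card_product]
        exact Nat.mul_le_mul (key _ _) (key _ _)

/-- a rational point together with a rational line through it -/
structure Tup (s t : ℝ) where
  q : ℕ
  p : ℤ
  r : ℤ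
  A : ℤ
  B : ℤ
  C : ℤ
  hq : 0 < q
  line : A * p + B * r + C * q = 0
  ne : A ≠ 0 ∨ B ≠ 0
  hA : |(A:ℝ)| ≤ (q:ℝ) ^ s
  hB : |(B:ℝ)| ≤ (q:ℝ) ^ t

namespace Tup
variable {s t : ℝ}

noncomputable def K (τ : Tup s t) : ℝ := max |(τ.A:ℝ)| |(τ.B:ℝ)|

def Near (c : ℝ) (τ : Tup s t) (u : ℝ × ℝ) : Prop :=
  (τ.q:ℝ) ^ s * |τ.q * u.1 - τ.p| ≤ c ∧ (τ.q:ℝ) ^ t * |τ.q * u.2 - τ.r| ≤ c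

noncomputable def e (τ : Tup s t) (u : ℝ × ℝ) : ℝ := τ.A * u.1 + τ.B * u.2 + τ.C

/-- class: `ρ` = radius at level `m`, `b = ε 4^(k-N)` -/
structure Cls (R : ℝ) (b ρ : ℝ) (k : ℕ) (τ : Tup s t) : Prop where
  k1 : 256 ^ k * τ.K ≤ (τ.q:ℝ) ^ s
  k2 : (τ.q:ℝ) ^ s < 256 ^ (k+1) * τ.K
  m1 : b ≤ ρ * (τ.q * τ.K)
  m2 : ρ * (τ.q * τ.K) < R * b

theorem one_le_q (τ : Tup s t) : (1:ℝ) ≤ τ.q := by exact_mod_cast τ.hq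

theorem one_le_K (τ : Tup s t) : 1 ≤ τ.K := by
  unfold K
  rcases τ.ne with h | h
  · exact le_max_of_le_left (by exact_mod_cast Int.one_le_abs h)
  · exact le_max_of_le_right (by exact_mod_cast Int.one_le_abs h)

theorem A_le_K (τ : Tup s t) : |(τ.A:ℝ)| ≤ τ.K := le_max_left _ _
theorem B_le_K (τ : Tup s t) : |(τ.B:ℝ)| ≤ τ.K := le_max_right _ _

theorem exists_tup (hst : s + t = 1) (q : ℕ) (hq : 0 < q) (p r : ℤ) :
    ∃ τ : Tup s t, τ.q = q ∧ τ.p = p ∧ τ.r = r := by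
  have hq1 : (1:ℝ) ≤ q := by exact_mod_cast hq
  have hq0 : (0:ℝ) < q := by linarith
  have : NeZero q := ⟨by omega⟩
  set a := ⌊(q:ℝ)^s⌋₊
  set b := ⌊(q:ℝ)^t⌋₊
  have hcard : (Finset.univ : Finset (ZMod q)).card <
      (Finset.range (a+1) ×ˢ Finset.range (b+1)).card := by
    rw [Finset.card_univ, ZMod.card, Finset.card_product, Finset.card_range, Finset.card_range]
    have h1 : (q:ℝ)^s < a + 1 := Nat.lt_floor_add_one _
    have h2 : (q:ℝ)^t < b + 1 := Nat.lt_floor_add_one _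
    have h3 : (q:ℝ)^s * (q:ℝ)^t = q := by
      rw [← Real.rpow_add hq0, hst, Real.rpow_one]
    have h4 : (0:ℝ) < (q:ℝ)^s := by positivity
    have h5 : (0:ℝ) < (q:ℝ)^t := by positivity
    have : (q:ℝ) < ((a+1)*(b+1) : ℕ) := by
      push_cast
      rw [← h3]
      exact mul_lt_mul'' h1 h2 h4.le h5.le
    exact_mod_cast this
  obtain ⟨x, hx, y, hy, hxy, he⟩ := Finset.exists_ne_map_eq_of_card_lt_of_maps_to hcard
    (f := fun x : ℕ × ℕ => ((x.1 * p + x.2 * r : ℤ) : ZMod q)) (fun x _ => Finset.mem_univ _)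
  simp only [Finset.mem_product, Finset.mem_range] at hx hy
  have hdvd : (q:ℤ) ∣ ((y.1 * p + y.2 * r) - (x.1 * p + x.2 * r) : ℤ) :=
    (ZMod.intCast_eq_intCast_iff_dvd_sub _ _ _).1 he
  obtain ⟨C, hC⟩ := hdvd
  have fa : (a:ℝ) ≤ (q:ℝ)^s := Nat.floor_le (by positivity)
  have fb : (b:ℝ) ≤ (q:ℝ)^t := Nat.floor_le (by positivity)
  refine ⟨⟨q, p, r, (y.1:ℤ) - x.1, (y.2:ℤ) - x.2, -C, hq, by linarith [hC], ?_, ?_, ?_⟩, rfl, rfl, rfl⟩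
  · by_contra hcon
    push Not at hcon
    apply hxy
    ext <;> omega
  · refine le_trans ?_ fa
    have : |(y.1:ℤ) - x.1| ≤ a := by rw [abs_le]; omega
    exact_mod_cast this
  · refine le_trans ?_ fb
    have : |(y.2:ℤ) - x.2| ≤ b := by rw [abs_le]; omega
    exact_mod_cast this

theorem cls_q_le {R b ρ : ℝ} {k : ℕ} {τ₁ τ₂ : Tup s t} (hs : 0 ≤ s) (hR : 0 ≤ R)
    (hρ : 0 < ρ) (h₁ : Cls R b ρ k τ₁) (h₂ : Cls R b ρ k τ₂) :
    (τ₁.q : ℝ) ≤ 256 * R * τ₂.q := by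
  by_contra hcon
  push Not at hcon
  have q1 := τ₁.one_le_q
  have q2 := τ₂.one_le_q
  have hK1 := τ₁.one_le_K
  have hK2 := τ₂.one_le_K
  have hlt : (256 * R * τ₂.q) * (τ₂.q:ℝ)^s ≤ τ₁.q * (τ₁.q:ℝ)^s ∨ (τ₁.q:ℝ) < τ₂.q := by
    rcases lt_or_ge (τ₁.q:ℝ) τ₂.q with h | h
    · right; exact h
    · left; gcongr
  have a1 : ρ * (τ₁.q * (τ₁.q:ℝ)^s) < 256 * R * (256 ^ k * b) := by
    have h1 := h₁.k2
    have h2 := h₁.m2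
    calc ρ * (τ₁.q * (τ₁.q:ℝ)^s) ≤ ρ * (τ₁.q * (256 ^ (k+1) * τ₁.K)) := by gcongr
      _ = 256 ^ (k+1) * (ρ * (τ₁.q * τ₁.K)) := by ring
      _ < 256 ^ (k+1) * (R * b) := by gcongr
      _ = _ := by ring
  have a2 : (256 ^ k * b) ≤ ρ * (τ₂.q * (τ₂.q:ℝ)^s) := by
    have h1 := h₂.k1
    have h2 := h₂.m1
    calc 256 ^ k * b ≤ 256 ^ k * (ρ * (τ₂.q * τ₂.K)) := by gcongr
      _ = ρ * (τ₂.q * (256 ^ k * τ₂.K)) := by ring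
      _ ≤ _ := by gcongr
  have a3 : ρ * (τ₁.q * (τ₁.q:ℝ)^s) < ρ * ((256 * R * τ₂.q) * (τ₂.q:ℝ)^s) := by
    calc _ < 256 * R * (256 ^ k * b) := a1
      _ ≤ 256 * R * (ρ * (τ₂.q * (τ₂.q:ℝ)^s)) := by gcongr
      _ = _ := by ring
  have a4 := lt_of_mul_lt_mul_left a3 hρ.le
  rcases hlt with h | h
  · linarith
  · -- then 256 R < 1, so b bounds contradict
    have hR1 : 256 * R < 1 := by
      by_contra h'
      push Not at h'
      nlinarith
    have hb : ρ * (τ₁.q * τ₁.K) < R * b := h₁.m2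
    have hb2 := h₁.m1
    have : 0 < ρ * (τ₁.q * τ₁.K) := by positivity
    nlinarith

theorem rpow_le_M {x y M a : ℝ} (hx : 0 ≤ x) (hy : 0 ≤ y) (hM : 1 ≤ M) (ha : 0 ≤ a) (ha1 : a ≤ 1)
    (h : x ≤ M * y) : x ^ a ≤ M * y ^ a := by
  calc x ^ a ≤ (M * y) ^ a := by gcongr
    _ = M ^ a * y ^ a := Real.mul_rpow (by linarith) hy
    _ ≤ M ^ (1:ℝ) * y ^ a := by gcongr
    _ = _ := by rw [Real.rpow_one]

theorem Cls.ebound {R b ρ c : ℝ} {k : ℕ} {τ : Tup s t} (h : Cls R b ρ k τ)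
    (hc : c ≤ R * b) {z u v : ℝ × ℝ} (hu : u ∈ Metric.closedBall z ρ)
    (hv : v ∈ Metric.closedBall z ρ) (hN : Near c τ v) : τ.q * |τ.e u| ≤ 6 * R * b := by
  rw [mem_cb] at hu hv
  have q1 := τ.one_le_q
  have hA := τ.A_le_K
  have hB := τ.B_le_K
  have hK := τ.one_le_K
  have hline : (τ.A:ℝ) * τ.p + τ.B * τ.r + τ.C * τ.q = 0 := by exact_mod_cast τ.line
  have e1 : τ.q * τ.e u = τ.A * (τ.q * v.1 - τ.p) + τ.B * (τ.q * v.2 - τ.r) +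
      τ.q * (τ.A * (u.1 - v.1)) + τ.q * (τ.B * (u.2 - v.2)) := by
    unfold e; linear_combination hline
  have d1 : |u.1 - v.1| ≤ 2 * ρ := by
    have := abs_sub_le u.1 z.1 v.1
    rw [abs_sub_comm z.1 v.1] at this; linarith [hu.1, hv.1]
  have d2 : |u.2 - v.2| ≤ 2 * ρ := by
    have := abs_sub_le u.2 z.2 v.2
    rw [abs_sub_comm z.2 v.2] at this; linarith [hu.2, hv.2]
  have b1 : |(τ.A:ℝ) * (τ.q * v.1 - τ.p)| ≤ c := by
    rw [abs_mul]; refine le_trans ?_ hN.1; gcongr; exact τ.hA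
  have b2 : |(τ.B:ℝ) * (τ.q * v.2 - τ.r)| ≤ c := by
    rw [abs_mul]; refine le_trans ?_ hN.2; gcongr; exact τ.hB
  have b3 : |(τ.q:ℝ) * (τ.A * (u.1 - v.1))| ≤ τ.q * (τ.K * (2 * ρ)) := by
    rw [abs_mul, abs_mul, abs_of_nonneg (by linarith : (0:ℝ) ≤ τ.q)]; gcongr
  have b4 : |(τ.q:ℝ) * (τ.B * (u.2 - v.2))| ≤ τ.q * (τ.K * (2 * ρ)) := by
    rw [abs_mul, abs_mul, abs_of_nonneg (by linarith : (0:ℝ) ≤ τ.q)]; gcongr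
  have : τ.q * |τ.e u| = |τ.q * τ.e u| := by
    rw [abs_mul, abs_of_nonneg (by linarith : (0:ℝ) ≤ τ.q)]
  rw [this, e1]
  have h4 := h.m2
  refine (abs_add_le _ _).trans ?_
  have t1 := abs_add_le ((τ.A:ℝ) * (τ.q * v.1 - τ.p) + τ.B * (τ.q * v.2 - τ.r)) (τ.q * (τ.A * (u.1 - v.1)))
  have t2 := abs_add_le ((τ.A:ℝ) * (τ.q * v.1 - τ.p)) (τ.B * (τ.q * v.2 - τ.r))
  nlinarith

/-- evaluate line 1 near point 2 -/
theorem cross_eval {M c : ℝ} {τ₁ τ₂ : Tup s t} (hs : 0 ≤ s) (ht : 0 ≤ t) (hst : s + t = 1)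
    (hM : 1 ≤ M) (hq : (τ₁.q:ℝ) ≤ M * τ₂.q) {u : ℝ × ℝ} (hN : Near c τ₂ u) :
    |τ₂.q * τ₁.e u - ((τ₁.A * τ₂.p + τ₁.B * τ₂.r + τ₁.C * τ₂.q : ℤ) : ℝ)| ≤ 2 * M * c := by
  have q1 := τ₁.one_le_q
  have q2 := τ₂.one_le_q
  have e1 : τ₂.q * τ₁.e u - ((τ₁.A * τ₂.p + τ₁.B * τ₂.r + τ₁.C * τ₂.q : ℤ) : ℝ) =
      τ₁.A * (τ₂.q * u.1 - τ₂.p) + τ₁.B * (τ₂.q * u.2 - τ₂.r) := by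
    unfold e; push_cast; ring
  rw [e1]
  have p1 : (τ₁.q:ℝ)^s ≤ M * (τ₂.q:ℝ)^s := rpow_le_M (by linarith) (by linarith) hM hs (by linarith) hq
  have p2 : (τ₁.q:ℝ)^t ≤ M * (τ₂.q:ℝ)^t := rpow_le_M (by linarith) (by linarith) hM ht (by linarith) hq
  have b1 : |(τ₁.A:ℝ) * (τ₂.q * u.1 - τ₂.p)| ≤ M * c := by
    rw [abs_mul]
    calc _ ≤ (M * (τ₂.q:ℝ)^s) * |τ₂.q * u.1 - τ₂.p| := by gcongr; exact τ₁.hA.trans p1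
      _ = M * ((τ₂.q:ℝ)^s * |τ₂.q * u.1 - τ₂.p|) := by ring
      _ ≤ _ := by gcongr; exact hN.1
  have b2 : |(τ₁.B:ℝ) * (τ₂.q * u.2 - τ₂.r)| ≤ M * c := by
    rw [abs_mul]
    calc _ ≤ (M * (τ₂.q:ℝ)^t) * |τ₂.q * u.2 - τ₂.r| := by gcongr; exact τ₁.hB.trans p2
      _ = M * ((τ₂.q:ℝ)^t * |τ₂.q * u.2 - τ₂.r|) := by ring
      _ ≤ _ := by gcongr; exact hN.2
  refine (abs_add_le _ _).trans ?_
  linarith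

/-- strip membership when `P₂ ∈ L₁`. -/
theorem mem_strip_of {R b ρ M c : ℝ} {k : ℕ} {τ₁ τ₂ : Tup s t} (hs : 0 ≤ s) (ht : 0 ≤ t) (hst : s + t = 1)
    (hM : 1 ≤ M) (hq : (τ₁.q:ℝ) ≤ M * τ₂.q) (hb : 0 < b) (hc : 0 ≤ c) (h₁ : Cls R b ρ k τ₁)
    {u : ℝ × ℝ} (hN : Near c τ₂ u)
    (h0 : τ₁.A * τ₂.p + τ₁.B * τ₂.r + τ₁.C * τ₂.q = 0) :
    u ∈ strip τ₁.A τ₁.B τ₁.C (2 * M ^ 2 * c / b * ρ) := by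
  have q1 := τ₁.one_le_q
  have q2 := τ₂.one_le_q
  have h := cross_eval hs ht hst hM hq hN
  rw [h0] at h
  simp only [Int.cast_zero, sub_zero, abs_mul, Nat.abs_cast] at h
  change |τ₁.e u| ≤ _ * τ₁.K
  have h2 : τ₁.q * |τ₁.e u| ≤ 2 * M ^ 2 * c := by
    calc τ₁.q * |τ₁.e u| ≤ M * τ₂.q * |τ₁.e u| := by gcongr
      _ = M * (τ₂.q * |τ₁.e u|) := by ring
      _ ≤ M * (2 * M * c) := by gcongr
      _ = _ := by ring
  have h3 : 2 * M ^ 2 * c ≤ τ₁.q * (2 * M ^ 2 * c / b * ρ * τ₁.K) := by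
    have : τ₁.q * (2 * M ^ 2 * c / b * ρ * τ₁.K) = 2 * M ^ 2 * c * ((ρ * (τ₁.q * τ₁.K)) / b) := by
      field_simp
    rw [this]
    have : 1 ≤ (ρ * (τ₁.q * τ₁.K)) / b := by rw [le_div_iff₀ hb]; linarith [h₁.m1]
    have : 0 ≤ 2 * M ^ 2 * c := by positivity
    nlinarith
  exact le_of_mul_le_mul_left (h2.trans h3) (by linarith)

/-- argument 1 -/
theorem arg1 {R b ρ M c : ℝ} {k : ℕ} {τ₁ τ₂ : Tup s t} (hs : 0 ≤ s) (ht : 0 ≤ t) (hst : s + t = 1)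
    (hM : 1 ≤ M) (hρ : 0 < ρ) (hq : (τ₁.q:ℝ) ≤ M * τ₂.q) (hq' : (τ₂.q:ℝ) ≤ M * τ₁.q)
    (hc : c ≤ R * b) (h₁ : Cls R b ρ k τ₁) (hlt : 6 * M * R * b + 2 * M * c < 1)
    {z v₁ v₂ : ℝ × ℝ} (hv₁ : v₁ ∈ Metric.closedBall z ρ) (hv₂ : v₂ ∈ Metric.closedBall z ρ)
    (hN₁ : Near c τ₁ v₁) (hN₂ : Near c τ₂ v₂) :
    τ₁.A * τ₂.p + τ₁.B * τ₂.r + τ₁.C * τ₂.q = 0 := by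
  have h := cross_eval hs ht hst hM hq hN₂
  have h2 := h₁.ebound hc hv₂ hv₁ hN₁
  have h3 : |τ₂.q * τ₁.e v₂| ≤ 6 * M * R * b := by
    rw [abs_mul, Nat.abs_cast]
    calc τ₂.q * |τ₁.e v₂| ≤ M * τ₁.q * |τ₁.e v₂| := by gcongr
      _ = M * (τ₁.q * |τ₁.e v₂|) := by ring
      _ ≤ M * (6 * R * b) := by gcongr
      _ = _ := by ring
  set n := τ₁.A * τ₂.p + τ₁.B * τ₂.r + τ₁.C * τ₂.q
  have : |(n:ℝ)| < 1 := by
    have : |(n:ℝ)| ≤ |τ₂.q * τ₁.e v₂| + |τ₂.q * τ₁.e v₂ - n| := by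
      have := abs_sub (τ₂.q * τ₁.e v₂) (τ₂.q * τ₁.e v₂ - n)
      simpa using this
    linarith
  exact Int.abs_lt_one_iff.1 (by exact_mod_cast this)

set_option maxHeartbeats 1000000 in
/-- argument 2 -/
theorem arg2 {R b ρ M c : ℝ} {k : ℕ} {τ₁ τ₂ : Tup s t} (hs : 1/2 ≤ s) (ht : 0 ≤ t) (hst : s + t = 1)
    (hM : 1 ≤ M) (hρ : 0 < ρ) (hb : 0 < b) (hR : 0 < R)
    (hq : (τ₁.q:ℝ) ≤ M * τ₂.q) (hq' : (τ₂.q:ℝ) ≤ M * τ₁.q)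
    (hc : c ≤ R * b) (hc0 : 0 < c) (h₁ : Cls R b ρ k τ₁) (h₂ : Cls R b ρ k τ₂)
    (hbig : 24 * M ^ 2 * R * b ≤ c * 16 ^ k) (hc1 : c ≤ 1)
    {z v₁ v₂ : ℝ × ℝ} (hv₁ : v₁ ∈ Metric.closedBall z ρ) (hv₂ : v₂ ∈ Metric.closedBall z ρ)
    (hN₁ : Near c τ₁ v₁) (hN₂ : Near c τ₂ v₂)
    (hne : τ₁.A * τ₂.p + τ₁.B * τ₂.r + τ₁.C * τ₂.q ≠ 0) :
    ∃ τ₀ : Tup s t, (∀ u ∈ Metric.closedBall z ρ, Near c τ₀ u) ∧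
      16 ^ k * (ρ * (τ₀.q * (τ₀.q:ℝ)^s)) < 1024 * M ^ 2 * R * b := by
  have hs0 : 0 ≤ s := by linarith
  have Q1 := τ₁.one_le_q
  have Q2 := τ₂.one_le_q
  have K1 := τ₁.one_le_K
  have K2 := τ₂.one_le_K
  set Q : ℝ := (τ₁.q : ℝ) with hQ
  set g : ℝ := 256 ^ k with hg
  have hg0 : 0 < g := by positivity
  have h16 : (16:ℝ) ^ k ≤ g := by rw [hg]; gcongr; norm_num
  have hg1 : 1 ≤ g := le_trans (one_le_pow₀ (by norm_num)) h16
  have hgs : (16:ℝ) ^ k ≤ g ^ s := by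
    calc (16:ℝ)^k = g ^ (1/2:ℝ) := by
          rw [hg, ← Real.sqrt_eq_rpow]
          rw [show (256:ℝ)^k = (16^k)^2 by rw [← pow_mul, mul_comm, pow_mul]; norm_num]
          rw [Real.sqrt_sq (by positivity)]
      _ ≤ g ^ s := Real.rpow_le_rpow_of_exponent_le hg1 hs
  set E := 6 * R * b with hE
  have hE0 : 0 < E := by positivity
  have hQst : Q ^ s * Q ^ t = Q := by
    rw [← Real.rpow_add (by linarith), hst, Real.rpow_one]
  have hQs0 : 0 < Q ^ s := by positivity
  have hQt0 : 0 < Q ^ t := by positivity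
  have hQsQ : Q ^ s ≤ Q := by
    calc Q ^ s ≤ Q ^ (1:ℝ) := Real.rpow_le_rpow_of_exponent_le Q1 (by linarith)
      _ = Q := Real.rpow_one _
  have p2s : (τ₂.q:ℝ)^s ≤ M * Q^s := rpow_le_M (by linarith) (by linarith) hM hs0 (by linarith) hq'
  have p2t : (τ₂.q:ℝ)^t ≤ M * Q^t := rpow_le_M (by linarith) (by linarith) hM ht (by linarith) hq'
  have k1 : g * τ₁.K ≤ Q ^ s := h₁.k1
  have k2 : g * τ₂.K ≤ M * Q ^ s := h₂.k1.trans p2s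
  have B1 : |(τ₁.B:ℝ)| ≤ Q ^ t := τ₁.hB
  have B2 : |(τ₂.B:ℝ)| ≤ M * Q ^ t := τ₂.hB.trans p2t
  have E1 : ∀ u ∈ Metric.closedBall z ρ, Q * |τ₁.e u| ≤ E := fun u hu =>
    h₁.ebound hc hu hv₁ hN₁
  have E2 : ∀ u ∈ Metric.closedBall z ρ, Q * |τ₂.e u| ≤ M * E := fun u hu => by
    have := h₂.ebound hc hu hv₂ hN₂
    calc Q * |τ₂.e u| ≤ M * τ₂.q * |τ₂.e u| := by gcongr
      _ = M * (τ₂.q * |τ₂.e u|) := by ring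
      _ ≤ M * E := by gcongr
  -- cross bounds
  have crossK : ∀ (a₁ a₂ : ℝ), |a₁| ≤ τ₁.K → |a₂| ≤ τ₂.K → ∀ u ∈ Metric.closedBall z ρ,
      g * Q * |a₁ * τ₂.e u - a₂ * τ₁.e u| ≤ 2 * M * E * Q ^ s := by
    intro a₁ a₂ ha₁ ha₂ u hu
    calc g * Q * |a₁ * τ₂.e u - a₂ * τ₁.e u| ≤ g * Q * (|a₁| * |τ₂.e u| + |a₂| * |τ₁.e u|) := by
          gcongr
          rw [← abs_mul, ← abs_mul]
          exact abs_sub _ _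
      _ ≤ g * Q * (τ₁.K * |τ₂.e u| + τ₂.K * |τ₁.e u|) := by gcongr
      _ = (g * τ₁.K) * (Q * |τ₂.e u|) + (g * τ₂.K) * (Q * |τ₁.e u|) := by ring
      _ ≤ Q ^ s * (M * E) + (M * Q ^ s) * E :=
          add_le_add (mul_le_mul k1 (E2 u hu) (by positivity) (by positivity))
            (mul_le_mul k2 (E1 u hu) (by positivity) (by positivity))
      _ = _ := by ring
  have crossB : ∀ u ∈ Metric.closedBall z ρ,
      Q * |τ₂.B * τ₁.e u - τ₁.B * τ₂.e u| ≤ 2 * M * E * Q ^ t := by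
    intro u hu
    calc Q * |τ₂.B * τ₁.e u - τ₁.B * τ₂.e u| ≤ Q * (|(τ₂.B:ℝ)| * |τ₁.e u| + |(τ₁.B:ℝ)| * |τ₂.e u|) := by
          gcongr
          rw [← abs_mul, ← abs_mul]
          exact abs_sub _ _
      _ = |(τ₂.B:ℝ)| * (Q * |τ₁.e u|) + |(τ₁.B:ℝ)| * (Q * |τ₂.e u|) := by ring
      _ ≤ (M * Q ^ t) * E + Q ^ t * (M * E) :=
          add_le_add (mul_le_mul B2 (E1 u hu) (by positivity) (by positivity))
            (mul_le_mul B1 (E2 u hu) (by positivity) (by positivity))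
      _ = _ := by ring
  have hMM : M ≤ M ^ 2 := by nlinarith
  have hME : 4 * M ^ 2 * E ≤ c * 16 ^ k := by rw [hE]; linarith
  have hMEg : 2 * M * E < g := by
    have : c * 16 ^ k ≤ 1 * g := by gcongr
    have : 2 * M * E < 4 * M ^ 2 * E := by
      have : 0 < M * E := by positivity
      nlinarith
    linarith
  by_cases hD : τ₁.A * τ₂.B - τ₂.A * τ₁.B = 0
  · exfalso
    have hDr : (τ₁.A:ℝ) * τ₂.B - τ₂.A * τ₁.B = 0 := by exact_mod_cast hD
    have small : ∀ n : ℤ, g * Q * |(n:ℝ)| ≤ 2 * M * E * Q ^ s → n = 0 := by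
      intro n hn
      by_contra h0
      have h1 : (1:ℝ) ≤ |(n:ℝ)| := by exact_mod_cast Int.one_le_abs h0
      have h2 : g * Q ≤ g * Q * |(n:ℝ)| := le_mul_of_one_le_right (by positivity) h1
      have h3 : 2 * M * E * Q ^ s ≤ 2 * M * E * Q := by gcongr
      have h4 : 2 * M * E * Q < g * Q := by gcongr
      linarith
    have zA : τ₁.A * τ₂.C - τ₂.A * τ₁.C = 0 := by
      apply small
      have := crossK τ₁.A τ₂.A τ₁.A_le_K τ₂.A_le_K v₁ hv₁
      convert this using 3
      push_cast
      unfold e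
      linear_combination (-v₁.2) * hDr
    have zB : τ₁.B * τ₂.C - τ₂.B * τ₁.C = 0 := by
      apply small
      have := crossK τ₁.B τ₂.B τ₁.B_le_K τ₂.B_le_K v₁ hv₁
      convert this using 3
      push_cast
      unfold e
      linear_combination (v₁.1) * hDr
    apply hne
    have hl := τ₂.line
    rcases τ₂.ne with h | h
    · apply mul_left_cancel₀ h
      linear_combination τ₁.A * hl - τ₂.r * hD - τ₂.q * zA
    · apply mul_left_cancel₀ h
      linear_combination τ₁.B * hl + τ₂.p * hD - τ₂.q * zB
  · set D : ℤ := τ₁.A * τ₂.B - τ₂.A * τ₁.B with hDdef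
    obtain ⟨τ₀, hτq, hτp, hτr⟩ := exists_tup hst D.natAbs (Int.natAbs_pos.2 hD)
      (-D.sign * (τ₂.B * τ₁.C - τ₁.B * τ₂.C)) (-D.sign * (τ₁.A * τ₂.C - τ₂.A * τ₁.C))
    have hq0r : (τ₀.q:ℝ) = |(D:ℝ)| := by
      rw [hτq, Nat.cast_natAbs]; push_cast; rfl
    have hsgn : (D.sign:ℝ) * D = τ₀.q := by
      rw [hq0r]
      have := Int.sign_mul_self_eq_abs D
      exact_mod_cast this
    have habs : |(D.sign:ℝ)| = 1 := by
      rcases lt_or_gt_of_ne hD with h | h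
      · rw [Int.sign_eq_neg_one_of_neg h]; simp
      · rw [Int.sign_eq_one_of_pos h]; simp
    have q0 := τ₀.one_le_q
    have hDle : g * τ₀.q ≤ 2 * M * Q := by
      rw [hq0r, hDdef]; push_cast
      calc g * |(τ₁.A:ℝ) * τ₂.B - τ₂.A * τ₁.B| ≤ g * (|(τ₁.A:ℝ)| * |(τ₂.B:ℝ)| + |(τ₂.A:ℝ)| * |(τ₁.B:ℝ)|) := by
            gcongr
            rw [← abs_mul, ← abs_mul]
            exact abs_sub _ _
        _ ≤ g * (τ₁.K * (M * Q ^ t) + τ₂.K * Q ^ t) := by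
            have := τ₁.A_le_K
            have := τ₂.A_le_K
            gcongr
        _ = (g * τ₁.K) * (M * Q ^ t) + (g * τ₂.K) * Q ^ t := by ring
        _ ≤ Q ^ s * (M * Q ^ t) + (M * Q ^ s) * Q ^ t := by gcongr
        _ = 2 * M * (Q ^ s * Q ^ t) := by ring
        _ = _ := by rw [hQst]
    have h2M : 1 ≤ 2 * M := by linarith
    have q0s : g ^ s * (τ₀.q:ℝ) ^ s ≤ 2 * M * Q ^ s := by
      rw [← Real.mul_rpow hg0.le (by linarith)]
      exact rpow_le_M (by positivity) (by linarith) h2M hs0 (by linarith) hDle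
    have q0t : (τ₀.q:ℝ) ^ t ≤ 2 * M * Q ^ t := by
      apply rpow_le_M (by positivity) (by linarith) h2M ht (by linarith)
      refine le_trans ?_ hDle
      exact le_mul_of_one_le_left (by positivity) hg1
    have q0s0 : 0 < (τ₀.q:ℝ) ^ s := by positivity
    have q0t0 : 0 < (τ₀.q:ℝ) ^ t := by positivity
    refine ⟨τ₀, ?_, ?_⟩
    · intro u hu
      constructor
      · have ex : |τ₀.q * u.1 - τ₀.p| = |τ₂.B * τ₁.e u - τ₁.B * τ₂.e u| := by
          have : τ₀.q * u.1 - τ₀.p = D.sign * (τ₂.B * τ₁.e u - τ₁.B * τ₂.e u) := by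
            rw [hτp, ← hsgn, hDdef]; push_cast; unfold e; ring
          rw [this, abs_mul, habs, one_mul]
        rw [ex]
        set X := |τ₂.B * τ₁.e u - τ₁.B * τ₂.e u|
        have hX : Q * X ≤ 2 * M * E * Q ^ t := crossB u hu
        have hX0 : 0 ≤ X := abs_nonneg _
        have : (16 ^ k * Q) * ((τ₀.q:ℝ)^s * X) ≤ (16 ^ k * Q) * c := by
          calc (16 ^ k * Q) * ((τ₀.q:ℝ)^s * X) ≤ (g ^ s * Q) * ((τ₀.q:ℝ)^s * X) := by gcongr
            _ = (g ^ s * (τ₀.q:ℝ)^s) * (Q * X) := by ring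
            _ ≤ (2 * M * Q ^ s) * (2 * M * E * Q ^ t) := by gcongr
            _ = 4 * M ^ 2 * E * (Q ^ s * Q ^ t) := by ring
            _ ≤ (c * 16 ^ k) * Q := by rw [hQst]; gcongr
            _ = _ := by ring
        exact le_of_mul_le_mul_left this (by positivity)
      · have ex : |τ₀.q * u.2 - τ₀.r| = |τ₁.A * τ₂.e u - τ₂.A * τ₁.e u| := by
          have : τ₀.q * u.2 - τ₀.r = D.sign * (τ₁.A * τ₂.e u - τ₂.A * τ₁.e u) := by
            rw [hτr, ← hsgn, hDdef]; push_cast; unfold e; ring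
          rw [this, abs_mul, habs, one_mul]
        rw [ex]
        set X := |τ₁.A * τ₂.e u - τ₂.A * τ₁.e u|
        have hX : g * Q * X ≤ 2 * M * E * Q ^ s := crossK _ _ τ₁.A_le_K τ₂.A_le_K u hu
        have hX0 : 0 ≤ X := abs_nonneg _
        have : (g * Q) * ((τ₀.q:ℝ)^t * X) ≤ (g * Q) * c := by
          calc (g * Q) * ((τ₀.q:ℝ)^t * X) = (τ₀.q:ℝ)^t * (g * Q * X) := by ring
            _ ≤ (2 * M * Q ^ t) * (2 * M * E * Q ^ s) := by gcongr
            _ = 4 * M ^ 2 * E * (Q ^ s * Q ^ t) := by ring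
            _ ≤ (c * 16 ^ k) * Q := by rw [hQst]; gcongr
            _ ≤ (c * g) * Q := by gcongr
            _ = _ := by ring
        exact le_of_mul_le_mul_left this (by positivity)
    · have a1 : ρ * (Q * Q ^ s) < 256 * g * (R * b) := by
        calc ρ * (Q * Q ^ s) < ρ * (Q * (256 ^ (k+1) * τ₁.K)) := by
              have := h₁.k2
              gcongr
          _ = 256 * g * (ρ * (Q * τ₁.K)) := by rw [hg]; ring
          _ ≤ _ := by
              have := h₁.m2.le
              gcongr
      have a2 : g * (16 ^ k * (ρ * (τ₀.q * (τ₀.q:ℝ)^s))) < g * (1024 * M ^ 2 * R * b) := by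
        calc g * (16 ^ k * (ρ * (τ₀.q * (τ₀.q:ℝ)^s))) ≤ g * (g ^ s * (ρ * (τ₀.q * (τ₀.q:ℝ)^s))) := by gcongr
          _ = ρ * ((g * τ₀.q) * (g ^ s * (τ₀.q:ℝ)^s)) := by ring
          _ ≤ ρ * ((2 * M * Q) * (2 * M * Q ^ s)) := by gcongr
          _ = 4 * M ^ 2 * (ρ * (Q * Q ^ s)) := by ring
          _ < 4 * M ^ 2 * (256 * g * (R * b)) := by gcongr
          _ = _ := by ring
      exact lt_of_mul_lt_mul_left a2 hg0.le

end Tup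

namespace Tup
variable {s t : ℝ}

theorem exists_cls (hs : 0 ≤ s) (ht : 0 ≤ t) (hst : s + t = 1) (hts : t ≤ s) (R : ℕ) (hR : 2 ≤ R)
    (ρ0 ε : ℝ) (hε : 0 < ε) (hερ : ε ≤ ρ0) (N : ℕ) (τ : Tup s t) :
    ∃ m k, Cls R (ε * 4 ^ (k - N)) (ρ0 / R ^ m) k τ := by
  have q1 := τ.one_le_q
  have K1 := τ.one_le_K
  have hR1 : (1:ℝ) < R := by exact_mod_cast (by omega : 1 < R)
  have hKq : τ.K ≤ (τ.q:ℝ) ^ s := by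
    refine max_le τ.hA (τ.hB.trans ?_)
    exact Real.rpow_le_rpow_of_exponent_le q1 hts
  obtain ⟨k, hk1, hk2⟩ := exists_nat_pow_near (x := (τ.q:ℝ)^s / τ.K) (y := 256)
    (by rw [le_div_iff₀ (by linarith)]; linarith) (by norm_num)
  rw [le_div_iff₀ (by linarith)] at hk1
  rw [div_lt_iff₀ (by linarith)] at hk2
  have h4 : (0:ℝ) < ε * 4 ^ (k - N) := by positivity
  have hqs : (τ.q:ℝ)^s ≤ τ.q := by
    calc (τ.q:ℝ)^s ≤ (τ.q:ℝ)^(1:ℝ) := Real.rpow_le_rpow_of_exponent_le q1 (by linarith)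
      _ = _ := Real.rpow_one _
  have h4q : (4:ℝ) ^ (k - N) ≤ τ.q := by
    calc (4:ℝ) ^ (k - N) ≤ 4 ^ k := pow_le_pow_right₀ (by norm_num) (by omega)
      _ ≤ 256 ^ k := by gcongr; norm_num
      _ ≤ 256 ^ k * τ.K := le_mul_of_one_le_right (by positivity) K1
      _ ≤ _ := hk1.trans hqs
  have hbase : 1 ≤ ρ0 * (τ.q * τ.K) / (ε * 4 ^ (k - N)) := by
    rw [le_div_iff₀ h4, one_mul]
    have : (τ.q:ℝ) ≤ τ.q * τ.K := le_mul_of_one_le_right (by linarith) K1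
    have hρ0 : 0 < ρ0 := by linarith
    gcongr
    linarith
  obtain ⟨m, hm1, hm2⟩ := exists_nat_pow_near hbase hR1
  rw [le_div_iff₀ h4] at hm1
  rw [div_lt_iff₀ h4] at hm2
  have hRm : (0:ℝ) < R ^ m := by positivity
  refine ⟨m, k, hk1, hk2, ?_, ?_⟩
  · rw [div_mul_eq_mul_div, le_div_iff₀ hRm]; linarith
  · rw [div_mul_eq_mul_div, div_lt_iff₀ hRm]
    rw [pow_succ] at hm2; linarith

theorem core (hs : 1/2 ≤ s) (ht : 0 ≤ t) (hst : s + t = 1) (R : ℕ) (hR : 2 ≤ R)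
    (ρ0 ε M : ℝ) (hM : M = 256 * R) (hε : 0 < ε) (hερ : ε ≤ ρ0) (hε2 : 24 * M ^ 2 * R * ε ≤ 1)
    (N : ℕ) (hN1 : (1/4:ℝ)^N ≤ ε) (hN2 : 1024 * M ^ 2 * R ≤ 4 ^ N) (m k : ℕ) (z : ℝ × ℝ) :
    ∃ L : ℝ × ℝ × ℝ, 0 < max |L.1| |L.2.1| ∧
      ((∀ τ : Tup s t, Cls R (ε * 4 ^ (k - N)) (ρ0 / R ^ m) k τ → ∀ u ∈ Metric.closedBall z (ρ0 / R ^ m),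
        Near ((1/4)^N) τ u → u ∈ strip L.1 L.2.1 L.2.2 (2 * M ^ 2 * (1/4)^N / (ε * 4 ^ (k - N)) * (ρ0 / R ^ m))) ∨
      ∃ (τ : Tup s t) (m0 k0 : ℕ), m0 < m ∧ Cls R (ε * 4 ^ (k0 - N)) (ρ0 / R ^ m0) k0 τ ∧
        ∀ u ∈ Metric.closedBall z (ρ0 / R ^ m), Near ((1/4)^N) τ u) := by
  have hs0 : 0 ≤ s := by linarith
  have hR1 : (1:ℝ) < R := by exact_mod_cast (by omega : 1 < R)
  have hR2 : (2:ℝ) ≤ R := by exact_mod_cast hR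
  have hM1 : 1 ≤ M := by rw [hM]; linarith
  have hMM : M ≤ M ^ 2 := by nlinarith
  have hρ0 : 0 < ρ0 := by linarith
  have hρ : 0 < ρ0 / R ^ m := by positivity
  have hc0 : (0:ℝ) < (1/4)^N := by positivity
  have hc1 : (1/4:ℝ)^N ≤ 1 := pow_le_one₀ (by norm_num) (by norm_num)
  have hc4 : (1/4:ℝ)^N * 4 ^ N = 1 := by rw [← mul_pow]; norm_num
  have hb0 : 0 < ε * 4 ^ (k - N) := by positivity
  have h41 : (1:ℝ) ≤ 4 ^ (k - N) := one_le_pow₀ (by norm_num)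
  have hcRb : (1/4:ℝ)^N ≤ R * (ε * 4 ^ (k - N)) := by
    calc (1/4:ℝ)^N ≤ ε := hN1
      _ ≤ ε * 4 ^ (k - N) := le_mul_of_one_le_right hε.le h41
      _ ≤ _ := le_mul_of_one_le_left hb0.le (by linarith)
  by_cases halt : ∃ (τ : Tup s t) (m0 k0 : ℕ), m0 < m ∧ Cls R (ε * 4 ^ (k0 - N)) (ρ0 / R ^ m0) k0 τ ∧
        ∀ u ∈ Metric.closedBall z (ρ0 / R ^ m), Near ((1/4)^N) τ u
  · exact ⟨(1, 0, 0), by simp, Or.inr halt⟩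
  by_cases hex : ∃ (τ : Tup s t) (v : ℝ × ℝ), Cls R (ε * 4 ^ (k - N)) (ρ0 / R ^ m) k τ ∧
      v ∈ Metric.closedBall z (ρ0 / R ^ m) ∧ Near ((1/4)^N) τ v
  swap
  · refine ⟨(1, 0, 0), by simp, Or.inl ?_⟩
    intro τ hτ u hu hN
    exact absurd ⟨τ, u, hτ, hu, hN⟩ hex
  obtain ⟨τ₁, v₁, h₁, hv₁, hN₁⟩ := hex
  refine ⟨(τ₁.A, τ₁.B, τ₁.C), lt_of_lt_of_le zero_lt_one τ₁.one_le_K, Or.inl ?_⟩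
  intro τ₂ h₂ v₂ hv₂ hN₂
  have hq : (τ₁.q:ℝ) ≤ M * τ₂.q := by
    rw [hM]; exact cls_q_le hs0 (by linarith) hρ h₁ h₂
  have hq' : (τ₂.q:ℝ) ≤ M * τ₁.q := by
    rw [hM]; exact cls_q_le hs0 (by linarith) hρ h₂ h₁
  refine mem_strip_of hs0 ht hst hM1 hq hb0 hc0.le h₁ hN₂ ?_
  by_contra hne
  rcases lt_or_ge k N with hk | hk
  · apply hne
    have e0 : k - N = 0 := by omega
    rw [e0, pow_zero, mul_one] at h₁ hcRb
    refine arg1 hs0 ht hst hM1 hρ hq hq' hcRb h₁ ?_ hv₁ hv₂ hN₁ hN₂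
    have a1 : 24 * M * R * ε ≤ 1 := by
      refine le_trans ?_ hε2
      gcongr
    have a2 : 1024 * M * (1/4:ℝ)^N ≤ 1 := by
      calc 1024 * M * (1/4:ℝ)^N ≤ 1024 * M ^ 2 * R * (1/4:ℝ)^N := by
            have : 1024 * M ≤ 1024 * M ^ 2 * R := by nlinarith [sq_nonneg M]
            exact mul_le_mul_of_nonneg_right this hc0.le
        _ ≤ 4 ^ N * (1/4:ℝ)^N := by gcongr
        _ = 1 := by rw [mul_comm]; exact hc4
    linarith
  · have e4 : (4:ℝ) ^ (k - N) = (1/4)^N * 4 ^ k := by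
      have : (4:ℝ) ^ k = 4 ^ (k - N) * 4 ^ N := by rw [← pow_add]; congr 1; omega
      rw [this]; linear_combination -(4:ℝ) ^ (k-N) * hc4
    have e16 : (16:ℝ)^k = 4 ^ k * 4 ^ k := by rw [← mul_pow]; norm_num
    have h4k : (1:ℝ) ≤ 4 ^ k := one_le_pow₀ (by norm_num)
    have hbig : 24 * M ^ 2 * R * (ε * 4 ^ (k - N)) ≤ (1/4)^N * 16 ^ k := by
      calc 24 * M ^ 2 * R * (ε * 4 ^ (k - N)) = (24 * M ^ 2 * R * ε) * 4 ^ (k - N) := by ring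
        _ ≤ 1 * 4 ^ (k - N) := by gcongr
        _ = (1/4)^N * (4 ^ k * 1) := by rw [e4]; ring
        _ ≤ (1/4)^N * (4 ^ k * 4 ^ k) := by gcongr
        _ = _ := by rw [e16]
    obtain ⟨τ₀, hnear, hsm⟩ := arg2 hs ht hst hM1 hρ hb0 (by linarith) hq hq' hcRb hc0 h₁ h₂ hbig hc1
      hv₁ hv₂ hN₁ hN₂ hne
    obtain ⟨m0, k0, h0⟩ := exists_cls hs0 ht hst (by linarith) R hR ρ0 ε hε hερ N τ₀
    apply halt
    refine ⟨τ₀, m0, k0, ?_, h0, hnear⟩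
    by_contra hm
    push Not at hm
    have q0 := τ₀.one_le_q
    have K0 := τ₀.one_le_K
    have hρm : ρ0 / (R:ℝ) ^ m0 ≤ ρ0 / R ^ m := by
      gcongr
      linarith
    have hK : τ₀.K ≤ (τ₀.q:ℝ)^s :=
      le_trans (le_mul_of_one_le_left (by linarith) (one_le_pow₀ (by norm_num))) h0.k1
    have h1 : ε ≤ ρ0 / R ^ m * (τ₀.q * (τ₀.q:ℝ)^s) := by
      calc ε ≤ ε * 4 ^ (k0 - N) := le_mul_of_one_le_right hε.le (one_le_pow₀ (by norm_num))
        _ ≤ ρ0 / R ^ m0 * (τ₀.q * τ₀.K) := h0.m1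
        _ ≤ _ := by gcongr
    have h2 : ε * 16 ^ k < ε * 4 ^ k := by
      calc ε * 16 ^ k = 16 ^ k * ε := by ring
        _ ≤ 16 ^ k * (ρ0 / R ^ m * (τ₀.q * (τ₀.q:ℝ)^s)) := by gcongr
        _ < 1024 * M ^ 2 * R * (ε * 4 ^ (k - N)) := hsm
        _ ≤ 4 ^ N * (ε * 4 ^ (k - N)) := by gcongr
        _ = ε * ((1/4)^N * 4 ^ N) * 4 ^ k := by rw [e4]; ring
        _ = ε * 4 ^ k := by rw [hc4, mul_one]
    have h3 := lt_of_mul_lt_mul_left h2 hε.le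
    have : (4:ℝ)^k ≤ 16 ^ k := by gcongr; norm_num
    linarith

end Tup

theorem mem_Bad2_of {s t c : ℝ} (hst : s + t = 1) (hc : 0 < c)
    (z : ℝ × ℝ) (h : ∀ τ : Tup s t, ¬ Tup.Near c τ z) : z ∈ Bad2 s t := by
  have : c ≤ ⨅ q : {q : ℕ // 0 < q},
      max ((q : ℝ) ^ s * dInt ((q : ℝ) * z.1)) ((q : ℝ) ^ t * dInt ((q : ℝ) * z.2)) := by
    have : Nonempty {q : ℕ // 0 < q} := ⟨⟨1, one_pos⟩⟩
    refine le_ciInf fun q => ?_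
    by_contra hlt
    push Not at hlt
    rw [max_lt_iff] at hlt
    have hq0 : (0:ℝ) < (q:ℕ) := by exact_mod_cast q.2
    have aux : ∀ a x : ℝ, ((q:ℕ):ℝ) ^ a * dInt x < c → ∃ n : ℤ, ((q:ℕ):ℝ) ^ a * |x - n| ≤ c := by
      intro a x hx
      have hp : 0 < ((q:ℕ):ℝ) ^ a := by positivity
      rw [mul_comm, ← lt_div_iff₀ hp] at hx
      obtain ⟨n, hn⟩ := exists_lt_of_ciInf_lt hx
      rw [lt_div_iff₀ hp] at hn
      exact ⟨n, by rw [mul_comm]; exact hn.le⟩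
    obtain ⟨p, hp⟩ := aux s _ hlt.1
    obtain ⟨r, hr⟩ := aux t _ hlt.2
    obtain ⟨τ, h1, h2, h3⟩ := Tup.exists_tup hst q.1 q.2 p r
    apply h τ
    unfold Tup.Near
    rw [h1, h2, h3]
    exact ⟨hp, hr⟩
  exact lt_of_lt_of_le hc this

/-- weight sums -/
theorem weights (W : ℝ) (hW : 0 ≤ W) (η : ℝ) (hη : 0 < η) :
    ∀ᶠ N : ℕ in Filter.atTop,
      ∑' k : ℕ, ENNReal.ofReal (√(W * ((1/4)^N / 4 ^ (k - N)))) ≤ ENNReal.ofReal η := by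
  set y : ℝ := √(1/2) with hy
  have hy0 : 0 ≤ y := Real.sqrt_nonneg _
  have hysq : y ^ 2 = 1/2 := Real.sq_sqrt (by norm_num)
  have hy1 : y < 1 := by nlinarith
  have hlim : Filter.Tendsto (fun N : ℕ => √W * (1 - y)⁻¹ * y ^ N) Filter.atTop (nhds (√W * (1 - y)⁻¹ * 0)) :=
    (tendsto_pow_atTop_nhds_zero_of_lt_one hy0 hy1).const_mul _
  rw [mul_zero] at hlim
  filter_upwards [hlim.eventually (gt_mem_nhds hη)] with N hN
  have hterm : ∀ k : ℕ, √(W * ((1/4)^N / 4 ^ (k - N))) ≤ √W * y ^ N * y ^ k := by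
    intro k
    rw [Real.sqrt_mul hW, mul_assoc]
    gcongr
    rw [Real.sqrt_le_left (by positivity)]
    rw [← pow_add, ← pow_mul, mul_comm (N+k) 2, pow_mul, hysq]
    have : ((1:ℝ)/4)^N / 4 ^ (k - N) = (1/2) ^ (2 * (N + (k - N))) := by
      rw [pow_mul, pow_add]; norm_num
      rw [div_eq_mul_inv, one_div_pow, one_div_pow, one_div (4 ^ (k - N))]
    rw [this]
    exact pow_le_pow_of_le_one (by norm_num) (by norm_num) (by omega)
  have hs : Summable (fun k : ℕ => √W * y ^ N * y ^ k) := (summable_geometric_of_lt_one hy0 hy1).mul_left _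
  calc _ ≤ ∑' k : ℕ, ENNReal.ofReal (√W * y ^ N * y ^ k) :=
        ENNReal.tsum_le_tsum fun k => ENNReal.ofReal_le_ofReal (hterm k)
    _ = ENNReal.ofReal (∑' k : ℕ, √W * y ^ N * y ^ k) :=
        (ENNReal.ofReal_tsum_of_nonneg (fun k => by positivity) hs).symm
    _ ≤ _ := by
        apply ENNReal.ofReal_le_ofReal
        rw [tsum_mul_left, tsum_geometric_of_lt_one hy0 hy1]
        linarith

theorem dioph_half (s t : ℝ) (hs : 1/2 ≤ s) (ht : 0 ≤ t) (hst : s + t = 1) (R : ℕ) (hR : 2 ≤ R)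
    (ρ0 : ℝ) (hρ0 : 0 < ρ0) (η : ℝ) (hη : 0 < η) :
    ∃ (κ : ℕ → ℝ) (L : ℕ → ℝ × ℝ → ℕ → ℝ × ℝ × ℝ), (∀ k, 0 < κ k) ∧
      (∑' k, ENNReal.ofReal (√(R * κ k)) ≤ ENNReal.ofReal η) ∧
      (∀ m z k, 0 < max |(L m z k).1| |(L m z k).2.1|) ∧
      ∀ (zs : ℕ → ℝ × ℝ) (z : ℝ × ℝ), (∀ m, z ∈ Metric.closedBall (zs m) (ρ0 / R ^ m)) →
        (∀ m k, z ∉ strip (L m (zs m) k).1 (L m (zs m) k).2.1 (L m (zs m) k).2.2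
          (κ k * (ρ0 / R ^ m))) → z ∈ Bad2 s t := by
  have hs0 : 0 ≤ s := by linarith
  have hR2 : (2:ℝ) ≤ R := by exact_mod_cast hR
  set M : ℝ := 256 * R with hM
  have hMpos : 0 < M := by positivity
  set ε : ℝ := min ρ0 (1 / (24 * M ^ 2 * R)) with hεdef
  have hε : 0 < ε := lt_min hρ0 (by positivity)
  have hερ : ε ≤ ρ0 := min_le_left _ _
  have hε2 : 24 * M ^ 2 * R * ε ≤ 1 := by
    have : ε ≤ 1 / (24 * M ^ 2 * R) := min_le_right _ _
    rw [le_div_iff₀ (by positivity)] at this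
    linarith
  have ev1 : ∀ᶠ N : ℕ in Filter.atTop, (1/4:ℝ)^N < ε :=
    (tendsto_pow_atTop_nhds_zero_of_lt_one (by norm_num) (by norm_num)).eventually (gt_mem_nhds hε)
  have ev2 : ∀ᶠ N : ℕ in Filter.atTop, 1024 * M ^ 2 * R ≤ (4:ℝ) ^ N :=
    (tendsto_pow_atTop_atTop_of_one_lt (by norm_num)).eventually_ge_atTop _
  obtain ⟨N, ⟨hN1, hN2⟩, hN3⟩ := ((ev1.and ev2).and (weights (R * (2 * M ^ 2 / ε)) (by positivity) η hη)).exists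
  choose L hL hcore using fun m z k => Tup.core hs ht hst R hR ρ0 ε M hM hε hερ hε2 N hN1.le hN2 m k z
  refine ⟨fun k => 2 * M ^ 2 * (1/4)^N / (ε * 4 ^ (k - N)), L, fun k => by positivity, ?_, hL, ?_⟩
  · refine le_trans (le_of_eq ?_) hN3
    congr 1
    ext k
    have : (R:ℝ) * (2 * M ^ 2 * (1/4)^N / (ε * 4 ^ (k - N))) = R * (2 * M ^ 2 / ε) * ((1/4)^N / 4 ^ (k - N)) := by
      field_simp
    show ENNReal.ofReal (√((R:ℝ) * (2 * M ^ 2 * (1/4)^N / (ε * 4 ^ (k - N))))) = _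
    rw [this]
  · intro zs z hz hstrip
    apply mem_Bad2_of hst (c := (1/4)^N) (by positivity)
    have main : ∀ m (τ : Tup s t) k, Tup.Cls R (ε * 4 ^ (k - N)) (ρ0 / R ^ m) k τ →
        ¬ Tup.Near ((1/4)^N) τ z := by
      intro m
      induction m using Nat.strong_induction_on with
      | _ m ih =>
        intro τ k hτ hnear
        rcases hcore m (zs m) k with h | ⟨τ0, m0, k0, hm0, h0, hall⟩
        · exact hstrip m k (h τ hτ z (hz m) hnear)
        · exact ih m0 hm0 τ0 k0 h0 (hall z (hz m))
    intro τ
    obtain ⟨m, k, h⟩ := Tup.exists_cls hs0 ht hst (by linarith) R hR ρ0 ε hε hερ N τ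
    exact main m τ k h

theorem dioph (s t : ℝ) (hs : 0 ≤ s) (ht : 0 ≤ t) (hst : s + t = 1) (R : ℕ) (hR : 2 ≤ R)
    (ρ0 : ℝ) (hρ0 : 0 < ρ0) (η : ℝ) (hη : 0 < η) :
    ∃ (κ : ℕ → ℝ) (L : ℕ → ℝ × ℝ → ℕ → ℝ × ℝ × ℝ), (∀ k, 0 < κ k) ∧
      (∑' k, ENNReal.ofReal (√(R * κ k)) ≤ ENNReal.ofReal η) ∧
      (∀ m z k, 0 < max |(L m z k).1| |(L m z k).2.1|) ∧
      ∀ (zs : ℕ → ℝ × ℝ) (z : ℝ × ℝ), (∀ m, z ∈ Metric.closedBall (zs m) (ρ0 / R ^ m)) →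
        (∀ m k, z ∉ strip (L m (zs m) k).1 (L m (zs m) k).2.1 (L m (zs m) k).2.2
          (κ k * (ρ0 / R ^ m))) → z ∈ Bad2 s t := by
  rcases le_total (1/2) s with h | h
  · exact dioph_half s t h ht hst R hR ρ0 hρ0 η hη
  · obtain ⟨κ, L, h1, h2, h3, h4⟩ := dioph_half t s (by linarith) hs (by linarith) R hR ρ0 hρ0 η hη
    refine ⟨κ, fun m z k => ((L m z.swap k).2.1, (L m z.swap k).1, (L m z.swap k).2.2), h1, h2, ?_, ?_⟩
    · intro m z k
      simp only
      rw [max_comm]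
      exact h3 m z.swap k
    · intro zs z hz hst'
      have := h4 (fun m => (zs m).swap) z.swap ?_ ?_
      · simp only [Bad2, mem_ofPred_eq, Prod.fst_swap, Prod.snd_swap] at this ⊢
        simpa only [max_comm] using this
      · intro m
        have := hz m
        rw [mem_cb] at this ⊢
        exact ⟨this.2, this.1⟩
      · intro m k hmem
        apply hst' m k
        simp only [strip, mem_ofPred_eq, Prod.fst_swap, Prod.snd_swap] at hmem ⊢
        rw [max_comm, add_comm (_ * z.1)]
        exact hmem

theorem cover_of_null {X : Type*} [MetricSpace X] [MeasurableSpace X] [BorelSpace X] (d : ℝ) (hd : 0 < d)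
    (s : Set X) (h : MeasureTheory.Measure.hausdorffMeasure d s = 0) (ε : ℝ) (hε : 0 < ε) :
    ∃ (t : ℕ → Set X) (u : ℕ → ℝ), s ⊆ ⋃ n, t n ∧ (∀ n, 0 < u n) ∧
      (∀ n, ∀ x ∈ t n, ∀ y ∈ t n, dist x y ≤ u n) ∧
      ∑' n, ENNReal.ofReal (u n ^ d) ≤ ENNReal.ofReal ε := by
  rw [MeasureTheory.Measure.hausdorffMeasure_apply] at h
  have h1 := (ENNReal.iSup_eq_zero.1 h) 1
  have h2 := (ENNReal.iSup_eq_zero.1 h1) zero_lt_one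
  have h3 : (⨅ (t : ℕ → Set X) (_ : s ⊆ ⋃ n, t n) (_ : ∀ n, Metric.ediam (t n) ≤ 1),
          ∑' n, ⨆ _ : (t n).Nonempty, Metric.ediam (t n) ^ d) < ENNReal.ofReal (ε/2) := by
    rw [h2]; simpa using hε
  simp only [iInf_lt_iff] at h3
  obtain ⟨t, hst, hdiam, hsum⟩ := h3
  set a : ℕ → ENNReal := fun n => ⨆ _ : (t n).Nonempty, Metric.ediam (t n) ^ d with ha
  have hatop : ∀ n, a n ≠ ⊤ := fun n =>
    ((ENNReal.le_tsum n).trans_lt (hsum.trans ENNReal.ofReal_lt_top)).ne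
  have hpos : ∀ n : ℕ, 0 < (a n).toReal + ε/2/2/2^n := fun n => by positivity
  refine ⟨t, fun n => ((a n).toReal + ε/2/2/2^n) ^ (1/d), hst, fun n => Real.rpow_pos_of_pos (hpos n) _, ?_, ?_⟩
  · intro n x hx y hy
    have e1 : ENNReal.ofReal (dist x y ^ d) ≤ a n := by
      rw [← ENNReal.ofReal_rpow_of_nonneg dist_nonneg hd.le, ← edist_dist]
      refine le_trans ?_ (le_iSup (fun _ : (t n).Nonempty => Metric.ediam (t n) ^ d) ⟨x, hx⟩)
      exact ENNReal.rpow_le_rpow (Metric.edist_le_ediam_of_mem hx hy) hd.le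
    have e2 : dist x y ^ d ≤ (a n).toReal := (ENNReal.ofReal_le_iff_le_toReal (hatop n)).1 e1
    have e3 : dist x y = (dist x y ^ d) ^ (1/d) := by
      rw [← Real.rpow_mul dist_nonneg, mul_one_div_cancel hd.ne', Real.rpow_one]
    rw [e3]
    have : 0 < ε/2/2/2^n := by positivity
    exact Real.rpow_le_rpow (by positivity) (by linarith) (by positivity)
  · have : ∀ n : ℕ, ENNReal.ofReal ((((a n).toReal + ε/2/2/2^n) ^ (1/d))^d) = a n + ENNReal.ofReal (ε/2/2/2^n) := by
      intro n
      rw [← Real.rpow_mul (hpos n).le, one_div, inv_mul_cancel₀ hd.ne', Real.rpow_one,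
        ENNReal.ofReal_add (by positivity) (by positivity), ENNReal.ofReal_toReal (hatop n)]
    simp only [this]
    rw [ENNReal.tsum_add, ← ENNReal.ofReal_tsum_of_nonneg (fun n => by positivity) (summable_geometric_two' _),
      tsum_geometric_two']
    calc _ ≤ ENNReal.ofReal (ε/2) + ENNReal.ofReal (ε/2) := by gcongr
      _ = _ := by rw [← ENNReal.ofReal_add (by positivity) (by positivity)]; congr 1; ring

open Classical in
theorem weight_step (R : ℕ) (P : Fin R × Fin R → Prop) (n : ℕ)
    (hn : (Finset.univ.filter P).card ≤ n) (b b' : ℝ) (h : n * b' ≤ R ^ 2 * (b / 2)) :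
    ∑ c : Fin R × Fin R, (if P c then ENNReal.ofReal b' else 0) ≤
      (Fintype.card (Fin R × Fin R) : ENNReal) * (2⁻¹ * ENNReal.ofReal b) := by
  rw [← Finset.sum_filter, Finset.sum_const, nsmul_eq_mul]
  have e2 : (2:ENNReal)⁻¹ = ENNReal.ofReal (1/2) := by
    rw [one_div, ENNReal.ofReal_inv_of_pos (by norm_num)]; simp
  calc ((Finset.univ.filter P).card : ENNReal) * ENNReal.ofReal b' ≤ (n:ENNReal) * ENNReal.ofReal b' := by
        gcongr
    _ = ENNReal.ofReal (n * b') := by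
        rw [ENNReal.ofReal_mul (by positivity), ENNReal.ofReal_natCast]
    _ ≤ ENNReal.ofReal (R ^ 2 * (b / 2)) := ENNReal.ofReal_le_ofReal h
    _ = _ := by
        rw [e2, ← ENNReal.ofReal_mul (by norm_num), Fintype.card_prod, Fintype.card_fin,
          ← ENNReal.ofReal_natCast, ← ENNReal.ofReal_mul (by positivity)]
        congr 1; push_cast; ring

theorem exists_R (d : ℝ) (hd : d < 2) : ∃ R : ℕ, 64 ≤ R ∧ 16 * (R:ℝ) ^ d ≤ R ^ 2 * (1 / 2) := by
  have h1 := (tendsto_rpow_atTop (y := 2 - d) (by linarith)).comp (tendsto_natCast_atTop_atTop (R := ℝ))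
  obtain ⟨R, hR1, hR2⟩ := ((h1.eventually_ge_atTop 32).and (Filter.eventually_ge_atTop 64)).exists
  refine ⟨R, hR2, ?_⟩
  have hR : (0:ℝ) < R := by exact_mod_cast (by omega : 0 < R)
  have : (R:ℝ)^2 = (R:ℝ)^(2-d) * (R:ℝ)^d := by
    rw [← Real.rpow_add hR, ← Real.rpow_natCast]; congr 1; push_cast; ring
  rw [this]
  have h3 : 32 ≤ (R:ℝ)^(2-d) := hR1
  have := Real.rpow_pos_of_pos hR d
  nlinarith

theorem sqrt_step (R : ℕ) (hR : 64 ≤ R) (y : ℝ) :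
    ((4 * R : ℕ):ℝ) * √(R * y) ≤ R ^ 2 * (√y / 2) := by
  have hR' : (64:ℝ) ≤ R := by exact_mod_cast hR
  rw [Real.sqrt_mul (by positivity)]
  have h8 : 8 ≤ √(R:ℝ) := by
    apply Real.le_sqrt_of_sq_le; linarith
  have hs : √(R:ℝ) * √(R:ℝ) = R := Real.mul_self_sqrt (by positivity)
  have key : 4 * (R:ℝ) * √(R:ℝ) ≤ R^2 / 2 := by
    nlinarith [mul_nonneg (by positivity : (0:ℝ) ≤ R) (by nlinarith : 0 ≤ (R:ℝ) - 8 * √(R:ℝ))]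
  push_cast
  nlinarith [mul_le_mul_of_nonneg_right key (Real.sqrt_nonneg y)]

theorem main_ne_zero (sn tn : ℕ → ℝ) (hs : ∀ n, 0 ≤ sn n) (ht : ∀ n, 0 ≤ tn n)
    (hst : ∀ n, sn n + tn n = 1) (x : ℝ × ℝ) (r : ℝ) (hr : 0 < r) (d : ℝ) (hd0 : 0 < d) (hd : d < 2) :
    MeasureTheory.Measure.hausdorffMeasure d (Metric.ball x r ∩ ⋂ n : ℕ, Bad2 (sn n) (tn n)) ≠ 0 := by
  intro hnull
  obtain ⟨R, hR64, hRd⟩ := exists_R d hd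
  have hRpos : 0 < R := by omega
  have : Nonempty (Fin R × Fin R) := ⟨(⟨0, hRpos⟩, ⟨0, hRpos⟩)⟩
  have hRr : (0:ℝ) < R := by exact_mod_cast hRpos
  have hR1 : (1:ℝ) < R := by exact_mod_cast (by omega : 1 < R)
  set ρ0 : ℝ := r / 2 with hρ0
  have hρ0p : 0 < ρ0 := by positivity
  have hRρ : 0 < ((R:ℝ) / ρ0) ^ d := Real.rpow_pos_of_pos (by positivity) d
  obtain ⟨T, u, hTc, hu, hTd, hTs⟩ := cover_of_null d hd0 _ hnull (1 / 8 / ((R:ℝ) / ρ0) ^ d) (by positivity)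
  choose κ L hκ hκs hL hBad using fun n => dioph (sn n) (tn n) (hs n) (ht n) (hst n) R (by omega) ρ0 hρ0p
    (1 / 8 / 2 / 2 ^ n) (by positivity)
  let ρ : ℕ → ℝ := fun m => ρ0 / R ^ m
  have hρ : ∀ m, 0 < ρ m := fun m => by positivity
  have hρs : ∀ m, ρ (m+1) = ρ m / R := fun m => by simp only [ρ]; rw [pow_succ]; field_simp
  have hratio : ∀ a : ℝ, 0 < a → ∃ᶠ m in Filter.atTop, 1 ≤ a / ρ m := by
    intro a ha
    have h1 : ∀ᶠ m : ℕ in Filter.atTop, ρ0 / a ≤ (R:ℝ) ^ m :=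
      (tendsto_pow_atTop_atTop_of_one_lt hR1).eventually_ge_atTop _
    refine (h1.mono fun m hm => ?_).frequently
    rw [one_le_div (hρ m)]
    simp only [ρ]
    rw [div_le_iff₀ (by positivity)]
    rwa [div_le_iff₀ ha, mul_comm] at hm
  let O : ℕ → ℝ × ℝ → (ℕ ⊕ (ℕ × ℕ)) → Set (ℝ × ℝ) := fun m z i =>
    Sum.elim (fun j => if m = 0 then T j else ∅)
      (fun p => strip (L p.1 m z p.2).1 (L p.1 m z p.2).2.1 (L p.1 m z p.2).2.2 (κ p.1 p.2 * ρ m)) i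
  let b : ℕ → (ℕ ⊕ (ℕ × ℕ)) → ℕ → ℝ := fun m i m' =>
    Sum.elim (fun j => if m = 0 then (R * u j / ρ m') ^ d else 0)
      (fun p => √(R * (κ p.1 p.2 * ρ m) / ρ m')) i
  have pg : ∃ (zs : ℕ → ℝ × ℝ) (z : ℝ × ℝ), zs 0 = x ∧ (∀ m, z ∈ Metric.closedBall (zs m) (ρ m)) ∧
      ∀ m i, z ∉ O m (zs m) i := by
    refine potential_game ρ (fun m => (hρ m).le) (fun m z c => chd R (ρ m) z c)
      (fun m z c => by rw [hρs]; exact chd_sub R (ρ m) z c (hρ m)) O (fun m i m' => ENNReal.ofReal (b m i m'))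
      ?_ ?_ ?_ x
    · intro m z i m' z' hlt
      have hlt' : b m i m' < 1 := by
        rwa [ENNReal.ofReal_lt_one] at hlt
      rcases i with j | ⟨n, k⟩
      · by_cases hm : m = 0
        · have hO : O m z (Sum.inl j) = T j := by simp [O, hm]
          rw [hO]
          simp only [b, Sum.elim_inl, hm, if_true] at hlt' ⊢
          have hbase : R * u j / ρ m' < 1 := by
            by_contra hcon
            exact absurd hlt' (not_lt.2 (Real.one_le_rpow (not_lt.1 hcon) hd0.le))
          have hδ : u j ≤ ρ m' / R := by
            rw [le_div_iff₀ hRr]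
            rw [div_lt_one (hρ m')] at hbase
            linarith
          rw [hρs]
          refine weight_step R _ 16 (ball_count R hRpos (ρ m') (hρ m') (T j) (u j) (hTd j) hδ z') _ _ ?_
          have : R * u j / (ρ m' / R) = R * (R * u j / ρ m') := by field_simp
          rw [this, Real.mul_rpow hRr.le (by have := hu j; have := hρ m'; positivity)]
          have h0 : 0 ≤ (R * u j / ρ m') ^ d := by have := hu j; have := hρ m'; positivity
          have := mul_le_mul_of_nonneg_right hRd h0
          push_cast
          linarith
        · simp [b, O, hm]
      · simp only [b, O, Sum.elim_inr] at hlt' ⊢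
        have hp : 0 < κ n k * ρ m := mul_pos (hκ n k) (hρ m)
        have hbase : R * (κ n k * ρ m) / ρ m' < 1 := by
          by_contra hcon
          exact absurd hlt' (not_lt.2 (Real.one_le_sqrt.2 (not_lt.1 hcon)))
        have hδ : κ n k * ρ m ≤ ρ m' / R := by
          rw [le_div_iff₀ hRr]
          rw [div_lt_one (hρ m')] at hbase
          linarith
        rw [hρs]
        refine weight_step R _ (4 * R) (strip_count R hRpos (ρ m') (hρ m') _ _ _ _ (hL n m z k) hδ z') _ _ ?_
        have : R * (κ n k * ρ m) / (ρ m' / R) = R * (R * (κ n k * ρ m) / ρ m') := by field_simp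
        rw [this]
        exact sqrt_step R hR64 _
    · intro m z i hne
      rcases i with j | ⟨n, k⟩
      · by_cases hm : m = 0
        · obtain ⟨m', hm', h1⟩ := Filter.frequently_atTop.1 (hratio (R * u j) (mul_pos hRr (hu j))) m
          refine ⟨m', hm', ?_⟩
          simp only [b, Sum.elim_inl, hm, if_true]
          rw [ENNReal.one_le_ofReal]
          exact Real.one_le_rpow h1 hd0.le
        · simp [O, hm] at hne
      · obtain ⟨m', hm', h1⟩ := Filter.frequently_atTop.1
          (hratio (R * (κ n k * ρ m)) (mul_pos hRr (mul_pos (hκ n k) (hρ m)))) m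
        refine ⟨m', hm', ?_⟩
        simp only [b, Sum.elim_inr]
        rw [ENNReal.one_le_ofReal]
        exact Real.one_le_sqrt.2 h1
    · intro m
      have e8 : ENNReal.ofReal (1/8) + ENNReal.ofReal (1/8) = 4⁻¹ := by
        rw [← ENNReal.ofReal_add (by norm_num) (by norm_num)]
        have : (1/8 + 1/8 : ℝ) = 4⁻¹ := by norm_num
        rw [this, ENNReal.ofReal_inv_of_pos (by norm_num)]; simp
      rw [Summable.tsum_sum ENNReal.summable ENNReal.summable, ← e8]
      refine add_le_add ?_ ?_
      · by_cases hm : m = 0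
        · have : ∀ j, ENNReal.ofReal (b m (Sum.inl j) m) = ENNReal.ofReal (((R:ℝ)/ρ0)^d) * ENNReal.ofReal (u j ^ d) := by
            intro j
            simp only [b, Sum.elim_inl, hm, if_true, ρ, pow_zero, div_one]
            rw [← ENNReal.ofReal_mul hRρ.le, ← Real.mul_rpow (by positivity) (hu j).le]
            congr 2; ring
          simp only [this]
          rw [ENNReal.tsum_mul_left]
          calc _ ≤ ENNReal.ofReal (((R:ℝ)/ρ0)^d) * ENNReal.ofReal (1 / 8 / ((R:ℝ) / ρ0) ^ d) := by gcongr
            _ = _ := by rw [← ENNReal.ofReal_mul hRρ.le]; congr 1; field_simp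
        · simp [b, hm]
      · rw [ENNReal.tsum_prod']
        have : ∀ n k, ENNReal.ofReal (b m (Sum.inr (n, k)) m) = ENNReal.ofReal (√(R * κ n k)) := by
          intro n k
          simp only [b, Sum.elim_inr]
          congr 2
          have := (hρ m).ne'
          field_simp
        simp only [this]
        calc _ ≤ ∑' n : ℕ, ENNReal.ofReal (1 / 8 / 2 / 2 ^ n) := ENNReal.tsum_le_tsum fun n => hκs n
          _ = _ := by
            rw [← ENNReal.ofReal_tsum_of_nonneg (fun n => by positivity) (summable_geometric_two' _),
              tsum_geometric_two']
  obtain ⟨zs, z, hz0, hz, hzO⟩ := pg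
  have hzball : z ∈ Metric.ball x r := by
    have := hz 0
    rw [hz0] at this
    simp only [ρ, pow_zero, div_one] at this
    exact Metric.closedBall_subset_ball (by linarith) this
  have hzb : z ∈ Metric.ball x r ∩ ⋂ n : ℕ, Bad2 (sn n) (tn n) := by
    refine ⟨hzball, Set.mem_iInter.2 fun n => hBad n zs z hz fun m k => hzO m (Sum.inr (n, k))⟩
  obtain ⟨j, hj⟩ := Set.mem_iUnion.1 (hTc hzb)
  have := hzO 0 (Sum.inl j)
  simp [O] at this
  exact this hj

/-- Corollary 2: if `s_n + t_n = 1` for all `n`, then `⋂ₙ Bad(s_n,t_n)` is thick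
in `ℝ²`: its intersection with every nonempty open ball has Hausdorff dimension `2`. -/
theorem bad2_inter_thick (sn tn : ℕ → ℝ) (hs : ∀ n, 0 ≤ sn n) (ht : ∀ n, 0 ≤ tn n)
    (hst : ∀ n, sn n + tn n = 1) :
    ∀ (x : ℝ × ℝ) (r : ℝ), 0 < r →
      dimH (Metric.ball x r ∩ ⋂ n : ℕ, Bad2 (sn n) (tn n)) = 2 := by
  intro x r hr
  apply le_antisymm
  · refine (dimH_mono (subset_univ _)).trans ?_
    rw [Real.dimH_univ_eq_finrank]
    simp
  · refine le_of_forall_lt fun c hc => ?_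
    obtain ⟨d, hd1, hd2⟩ := ENNReal.lt_iff_exists_nnreal_btwn.1 hc
    refine lt_of_lt_of_le hd1 (le_dimH_of_hausdorffMeasure_ne_zero ?_)
    have h0 : 0 < d := by
      have : (0:ENNReal) < d := lt_of_le_of_lt (zero_le) hd1
      exact_mod_cast this
    have h2 : d < 2 := by exact_mod_cast hd2
    exact main_ne_zero sn tn hs ht hst x r hr d (by exact_mod_cast h0) (by exact_mod_cast h2)
end
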